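/- Let (R, m) be a commutative Noetherian local ring, let 𝔞 be a proper ideal of R, let M be an R-module, and let n be a non-negative integer such that H^i_𝔞(M) = 0 for all i ≠ n. Then: (i) if the flat dimension fd_R M is finite, then fd_R H^n_𝔞(M) is finite; (ii) conversely, if M is finitely generated and fd_R H^n_𝔞(M) is finite, then fd_R M is finite. Furthermore, if M is non-zero and finitely generated, then fd_R H^n_𝔞(M) = fd_R M + n = pd_R M + n. -/

import Mathlib

/-!
Definitions needed to state results of "On flat and Gorenstein flat dimensions of
local cohomology modules" by M.R. Zargar and H. Zakeri.
-/

open CategoryTheory IsLocalRing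

universe u

namespace Paper

variable (R : Type u) [CommRing R]

/-! ## Resolution/coresolution dimensions with respect to a class of modules -/

/-- `ResDimLE R P n M` : `M` admits a resolution `0 → Xₙ → ⋯ → X₀ → M → 0`
with each `Xᵢ` in the class `P`. -/
def ResDimLE (P : ModuleCat.{u} R → Prop) : ℕ → ModuleCat.{u} R → Prop
  | 0, M => P M
  | n + 1, M => ResDimLE P n M ∨
      ∃ (X : ModuleCat.{u} R) (f : X →ₗ[R] M), P X ∧ Function.Surjective f ∧
        ResDimLE P n (ModuleCat.of R (LinearMap.ker f))

/-- `CoresDimLE R P n M` : `M` admits a coresolution `0 → M → X₀ → ⋯ → Xₙ → 0`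
with each `Xᵢ` in the class `P`. -/
def CoresDimLE (P : ModuleCat.{u} R → Prop) : ℕ → ModuleCat.{u} R → Prop
  | 0, M => P M
  | n + 1, M => CoresDimLE P n M ∨
      ∃ (X : ModuleCat.{u} R) (f : M →ₗ[R] X), P X ∧ Function.Injective f ∧
        CoresDimLE P n (ModuleCat.of R (X ⧸ LinearMap.range f))

/-- The resolution dimension of `M` with respect to the class `P`, as an
extended natural number (`⊤` if there is no finite resolution). -/
noncomputable def ResDim (P : ModuleCat.{u} R → Prop) (M : ModuleCat.{u} R) : ℕ∞ :=
  sInf {n : ℕ∞ | ∃ k : ℕ, (k : ℕ∞) = n ∧ ResDimLE R P k M}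

/-- The coresolution dimension of `M` with respect to the class `P`. -/
noncomputable def CoresDim (P : ModuleCat.{u} R → Prop) (M : ModuleCat.{u} R) : ℕ∞ :=
  sInf {n : ℕ∞ | ∃ k : ℕ, (k : ℕ∞) = n ∧ CoresDimLE R P k M}

/-- Flat dimension `fd_R M`. -/
noncomputable def flatDim (M : Type u) [AddCommGroup M] [Module R M] : ℕ∞ :=
  ResDim R (fun N => Module.Flat R N) (ModuleCat.of R M)

/-- Projective dimension `pd_R M`. -/
noncomputable def projDim (M : Type u) [AddCommGroup M] [Module R M] : ℕ∞ :=
  ResDim R (fun N => Module.Projective R N) (ModuleCat.of R M)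

/-- Injective dimension `id_R M`. -/
noncomputable def injDim (M : Type u) [AddCommGroup M] [Module R M] : ℕ∞ :=
  CoresDim R (fun N => Module.Injective R N) (ModuleCat.of R M)

/-! ## Local cohomology -/

/-- The local cohomology module `H^i_𝔞(M)`, as an object of `ModuleCat R`. -/
noncomputable def lcoh (𝔞 : Ideal R) (i : ℕ) (M : Type u) [AddCommGroup M] [Module R M] :
    ModuleCat.{u} R :=
  (localCohomology 𝔞 i).obj (ModuleCat.of R M)

/-- `M` is relative Cohen-Macaulay with respect to `𝔞` with `ht_M 𝔞 = n`, i.e. the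
`n`-th local cohomology of `M` with respect to `𝔞` is the only non-vanishing one. -/
def IsRelCM (𝔞 : Ideal R) (n : ℕ) (M : Type u) [AddCommGroup M] [Module R M] : Prop :=
  (∀ i : ℕ, i ≠ n → Subsingleton (lcoh R 𝔞 i M)) ∧ ¬ Subsingleton (lcoh R 𝔞 n M)

/-! ## Depth, dimension, Cohen-Macaulay -/

/-- The depth of a module over a local ring: the supremum of the lengths of
`M`-regular sequences contained in the maximal ideal. -/
noncomputable def depth [IsLocalRing R] (M : Type u) [AddCommGroup M] [Module R M] : ℕ∞ :=
  sSup {n : ℕ∞ | ∃ rs : List R, (rs.length : ℕ∞) = n ∧ (∀ x ∈ rs, x ∈ maximalIdeal R) ∧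
    RingTheory.Sequence.IsRegular M rs}

/-- The (Krull) dimension of a module: the Krull dimension of `R` modulo
the annihilator of `M` (`⊥` for the zero module). -/
noncomputable def moduleDim (M : Type u) [AddCommGroup M] [Module R M] : WithBot ℕ∞ :=
  ringKrullDim (R ⧸ Module.annihilator R M)

/-- A finitely generated module over a local ring is Cohen-Macaulay
if its depth equals its dimension. -/
def IsCohenMacaulayModule [IsLocalRing R] (M : Type u) [AddCommGroup M] [Module R M] : Prop :=
  (depth R M : WithBot ℕ∞) = moduleDim R M

/-- A local ring is Cohen-Macaulay if it is so as a module over itself. -/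
def IsCohenMacaulayRing [IsLocalRing R] : Prop := IsCohenMacaulayModule R R

/-- A local ring is Gorenstein if it has finite injective dimension over itself. -/
def IsGorensteinRing : Prop := injDim R R ≠ ⊤

/-! ## Ext, Tor, semidualizing modules -/

/-- `Ext^i_R(A, B)`. -/
noncomputable def ext (i : ℕ) (A B : Type u) [AddCommGroup A] [Module R A]
    [AddCommGroup B] [Module R B] : ModuleCat.{u} R :=
  ((Ext R (ModuleCat.{u} R) i).obj (Opposite.op (ModuleCat.of R A))).obj (ModuleCat.of R B)

/-- `Tor^R_p(A, B)` indexed by `p : ℤ`, with the convention that it vanishes in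
negative degrees. -/
noncomputable def tor (p : ℤ) (A B : Type u) [AddCommGroup A] [Module R A]
    [AddCommGroup B] [Module R B] : ModuleCat.{u} R :=
  if 0 ≤ p then ((Tor (ModuleCat.{u} R) p.toNat).obj (ModuleCat.of R A)).obj (ModuleCat.of R B)
  else ModuleCat.of R PUnit

/-- A finitely generated module `C` is semidualizing if the natural map
`R → Hom_R(C, C)` is bijective and `Ext^i_R(C, C) = 0` for all `i ≥ 1`. -/
def IsSemidualizing (C : Type u) [AddCommGroup C] [Module R C] : Prop :=
  Module.Finite R C ∧
  Function.Bijective (fun r : R => (r • LinearMap.id : C →ₗ[R] C)) ∧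
  ∀ i : ℕ, 1 ≤ i → Subsingleton (ext R i C C)

/-! ## Gorenstein homological classes -/

/-- `N` is Gorenstein injective: it is the kernel of the `0`-th differential of some
exact complex `Y` of injective modules which stays exact under `Hom(I, -)` for every
injective module `I`. (The complex is written cohomologically.) -/
def IsGorensteinInjective (N : Type u) [AddCommGroup N] [Module R N] : Prop :=
  ∃ (Y : ℤ → ModuleCat.{u} R) (d : ∀ i : ℤ, Y i →ₗ[R] Y (i + 1)),
    (∀ i, Module.Injective R (Y i)) ∧
    (∀ i, Function.Exact (d i) (d (i + 1))) ∧
    (∀ (I : ModuleCat.{u} R), Module.Injective R I →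
      ∀ (i : ℤ) (g : I →ₗ[R] Y (i + 1)), (d (i + 1)).comp g = 0 →
        ∃ h : I →ₗ[R] Y i, (d i).comp h = g) ∧
    ∃ ι : N →ₗ[R] Y 0, Function.Injective ι ∧ Function.Exact ι (d 0)

/-- `N` is Gorenstein projective: it is the cokernel of a differential of some
exact complex `X` of projective modules which stays exact under `Hom(-, P)` for
every projective module `P`. -/
def IsGorensteinProjective (N : Type u) [AddCommGroup N] [Module R N] : Prop :=
  ∃ (X : ℤ → ModuleCat.{u} R) (d : ∀ i : ℤ, X i →ₗ[R] X (i + 1)),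
    (∀ i, Module.Projective R (X i)) ∧
    (∀ i, Function.Exact (d i) (d (i + 1))) ∧
    (∀ (P : ModuleCat.{u} R), Module.Projective R P →
      ∀ (i : ℤ) (g : X (i + 1) →ₗ[R] P), g.comp (d i) = 0 →
        ∃ h : X (i + 1 + 1) →ₗ[R] P, h.comp (d (i + 1)) = g) ∧
    ∃ π : X 0 →ₗ[R] N, Function.Surjective π ∧ Function.Exact (d (-1)) π

/-- `N` is Gorenstein flat: it is the cokernel of a differential of some exact
complex `Z` of flat modules which stays exact under `- ⊗ I` for every injective
module `I`. -/
def IsGorensteinFlat (N : Type u) [AddCommGroup N] [Module R N] : Prop :=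
  ∃ (Z : ℤ → ModuleCat.{u} R) (d : ∀ i : ℤ, Z i →ₗ[R] Z (i + 1)),
    (∀ i, Module.Flat R (Z i)) ∧
    (∀ i, Function.Exact (d i) (d (i + 1))) ∧
    (∀ (I : ModuleCat.{u} R), Module.Injective R I →
      ∀ i : ℤ, Function.Exact (LinearMap.rTensor (R := R) I (d i))
        (LinearMap.rTensor (R := R) I (d (i + 1)))) ∧
    ∃ π : Z 0 →ₗ[R] N, Function.Surjective π ∧ Function.Exact (d (-1)) π

/-- Gorenstein injective dimension `Gid_R M`. -/
noncomputable def GinjDim (M : Type u) [AddCommGroup M] [Module R M] : ℕ∞ :=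
  CoresDim R (fun N => IsGorensteinInjective R N) (ModuleCat.of R M)

/-- Gorenstein projective dimension `Gpd_R M`. -/
noncomputable def GprojDim (M : Type u) [AddCommGroup M] [Module R M] : ℕ∞ :=
  ResDim R (fun N => IsGorensteinProjective R N) (ModuleCat.of R M)

/-- Gorenstein flat dimension `Gfd_R M`. -/
noncomputable def GflatDim (M : Type u) [AddCommGroup M] [Module R M] : ℕ∞ :=
  ResDim R (fun N => IsGorensteinFlat R N) (ModuleCat.of R M)

/-! ## `C`-injective, `C`-projective, `C`-flat modules and the `G_C`-classes -/

/-- `N` is `C`-injective if `N ≅ Hom_R(C, I)` for some injective module `I`. -/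
def IsCInjective (C : Type u) [AddCommGroup C] [Module R C]
    (N : Type u) [AddCommGroup N] [Module R N] : Prop :=
  ∃ I : ModuleCat.{u} R, Module.Injective R I ∧ Nonempty (N ≃ₗ[R] (C →ₗ[R] I))

/-- `N` is `C`-projective if `N ≅ C ⊗_R P` for some projective module `P`. -/
def IsCProjective (C : Type u) [AddCommGroup C] [Module R C]
    (N : Type u) [AddCommGroup N] [Module R N] : Prop :=
  ∃ P : ModuleCat.{u} R, Module.Projective R P ∧ Nonempty (N ≃ₗ[R] TensorProduct R C P)

/-- `N` is `C`-flat if `N ≅ C ⊗_R F` for some flat module `F`. -/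
def IsCFlat (C : Type u) [AddCommGroup C] [Module R C]
    (N : Type u) [AddCommGroup N] [Module R N] : Prop :=
  ∃ F : ModuleCat.{u} R, Module.Flat R F ∧ Nonempty (N ≃ₗ[R] TensorProduct R C F)

/-- `C`-injective dimension `cid_R M`. -/
noncomputable def cInjDim (C : Type u) [AddCommGroup C] [Module R C]
    (M : Type u) [AddCommGroup M] [Module R M] : ℕ∞ :=
  CoresDim R (fun N => IsCInjective R C N) (ModuleCat.of R M)

/-- `C`-projective dimension `cpd_R M`. -/
noncomputable def cProjDim (C : Type u) [AddCommGroup C] [Module R C]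
    (M : Type u) [AddCommGroup M] [Module R M] : ℕ∞ :=
  ResDim R (fun N => IsCProjective R C N) (ModuleCat.of R M)

/-- `N` is `G_C`-injective: `N` is the kernel of the `0`-th differential of an exact
complex `Y` (a complete `I_C I`-coresolution) with `Y i` injective in degrees belonging
to the coresolution part and `C`-injective elsewhere, such that `Hom(I', Y)` is exact
for every `C`-injective module `I'`. -/
def IsGCInjective (C : Type u) [AddCommGroup C] [Module R C]
    (N : Type u) [AddCommGroup N] [Module R N] : Prop :=
  ∃ (Y : ℤ → ModuleCat.{u} R) (d : ∀ i : ℤ, Y i →ₗ[R] Y (i + 1)),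
    (∀ i : ℤ, 0 ≤ i → Module.Injective R (Y i)) ∧
    (∀ i : ℤ, i < 0 → IsCInjective R C (Y i)) ∧
    (∀ i, Function.Exact (d i) (d (i + 1))) ∧
    (∀ (I : ModuleCat.{u} R), IsCInjective R C I →
      ∀ (i : ℤ) (g : I →ₗ[R] Y (i + 1)), (d (i + 1)).comp g = 0 →
        ∃ h : I →ₗ[R] Y i, (d i).comp h = g) ∧
    ∃ ι : N →ₗ[R] Y 0, Function.Injective ι ∧ Function.Exact ι (d 0)

/-- `N` is `G_C`-projective: the cokernel of the degree `0` differential of a complete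
`P_C P`-resolution. -/
def IsGCProjective (C : Type u) [AddCommGroup C] [Module R C]
    (N : Type u) [AddCommGroup N] [Module R N] : Prop :=
  ∃ (X : ℤ → ModuleCat.{u} R) (d : ∀ i : ℤ, X i →ₗ[R] X (i + 1)),
    (∀ i : ℤ, i ≤ 0 → Module.Projective R (X i)) ∧
    (∀ i : ℤ, 0 < i → IsCProjective R C (X i)) ∧
    (∀ i, Function.Exact (d i) (d (i + 1))) ∧
    (∀ (Q : ModuleCat.{u} R), IsCProjective R C Q →
      ∀ (i : ℤ) (g : X (i + 1) →ₗ[R] Q), g.comp (d i) = 0 →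
        ∃ h : X (i + 1 + 1) →ₗ[R] Q, h.comp (d (i + 1)) = g) ∧
    ∃ π : X 0 →ₗ[R] N, Function.Surjective π ∧ Function.Exact (d (-1)) π

/-- `N` is `G_C`-flat: the cokernel of the degree `0` differential of a complete
`F_C F`-resolution. -/
def IsGCFlat (C : Type u) [AddCommGroup C] [Module R C]
    (N : Type u) [AddCommGroup N] [Module R N] : Prop :=
  ∃ (Z : ℤ → ModuleCat.{u} R) (d : ∀ i : ℤ, Z i →ₗ[R] Z (i + 1)),
    (∀ i : ℤ, i ≤ 0 → Module.Flat R (Z i)) ∧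
    (∀ i : ℤ, 0 < i → IsCFlat R C (Z i)) ∧
    (∀ i, Function.Exact (d i) (d (i + 1))) ∧
    (∀ (J : ModuleCat.{u} R), IsCInjective R C J →
      ∀ i : ℤ, Function.Exact (LinearMap.rTensor (R := R) J (d i))
        (LinearMap.rTensor (R := R) J (d (i + 1)))) ∧
    ∃ π : Z 0 →ₗ[R] N, Function.Surjective π ∧ Function.Exact (d (-1)) π

/-- `G_C`-injective dimension `Gid_C M`. -/
noncomputable def GCinjDim (C : Type u) [AddCommGroup C] [Module R C]
    (M : Type u) [AddCommGroup M] [Module R M] : ℕ∞ :=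
  CoresDim R (fun N => IsGCInjective R C N) (ModuleCat.of R M)

/-- `G_C`-projective dimension `G_C-pd_R M`. -/
noncomputable def GCprojDim (C : Type u) [AddCommGroup C] [Module R C]
    (M : Type u) [AddCommGroup M] [Module R M] : ℕ∞ :=
  ResDim R (fun N => IsGCProjective R C N) (ModuleCat.of R M)

/-- `G_C`-flat dimension `G_C-fd_R M`. -/
noncomputable def GCflatDim (C : Type u) [AddCommGroup C] [Module R C]
    (M : Type u) [AddCommGroup M] [Module R M] : ℕ∞ :=
  ResDim R (fun N => IsGCFlat R C N) (ModuleCat.of R M)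

end Paper

open Paper IsLocalRing
namespace FLC
open Abelian

section dual
variable {R : Type u} [CommRing R]

/-- the character dual as an object of `ModuleCat R` -/
noncomputable abbrev dl (R : Type u) [CommRing R] (N : Type u) [AddCommGroup N] [Module R N] :
    ModuleCat.{u} R := ModuleCat.of R (CharacterModule N)

/-- flat dimension at most `d`, through the injective dimension of the character dual -/
def FD (R : Type u) [CommRing R] (d : ℕ) (N : Type u) [AddCommGroup N] [Module R N] : Prop :=
  HasInjectiveDimensionLE (dl R N) d

variable {A B C : Type u} [AddCommGroup A] [Module R A] [AddCommGroup B] [Module R B]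
  [AddCommGroup C] [Module R C]

lemma dual_exact (f : A →ₗ[R] B) (g : B →ₗ[R] C) (hg : Function.Surjective g)
    (hfg : Function.Exact f g) :
    Function.Exact (CharacterModule.dual g) (CharacterModule.dual f) := by
  intro c
  constructor
  · intro hc
    have h0 : ∀ a, c (f a) = 0 := fun a => DFunLike.congr_fun hc a
    let g' : B →+ C := g.toAddMonoidHom
    have hker : g'.ker ≤ AddMonoidHom.ker (c : B →+ _) := by
      intro b hb
      obtain ⟨a, rfl⟩ := (hfg b).1 hb
      exact h0 a
    refine ⟨g'.liftOfSurjective hg ⟨c, hker⟩, ?_⟩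
    ext b
    exact AddMonoidHom.liftOfRightInverse_comp_apply g' _ (Function.rightInverse_surjInv hg) ⟨c, hker⟩ b
  · rintro ⟨c, rfl⟩
    ext a
    show c (g (f a)) = 0
    rw [(hfg (f a)).2 ⟨a, rfl⟩, map_zero]

/-- the dual short complex -/
noncomputable abbrev dS (f : A →ₗ[R] B) (g : B →ₗ[R] C) (hg : Function.Surjective g)
    (hfg : Function.Exact f g) : ShortComplex (ModuleCat.{u} R) :=
  ShortComplex.mk (X₁ := dl R C) (X₂ := dl R B) (X₃ := dl R A)
    (ModuleCat.ofHom (CharacterModule.dual g)) (ModuleCat.ofHom (CharacterModule.dual f))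
    (by ext x : 2; exact (dual_exact f g hg hfg _).2 ⟨x, rfl⟩)

lemma dS_shortExact (f : A →ₗ[R] B) (g : B →ₗ[R] C) (hf : Function.Injective f)
    (hg : Function.Surjective g) (hfg : Function.Exact f g) : (dS f g hg hfg).ShortExact where
  exact := by
    rw [ShortComplex.ShortExact.moduleCat_exact_iff_function_exact]
    exact dual_exact f g hg hfg
  mono_f := (ModuleCat.mono_iff_injective _).2 (CharacterModule.dual_injective_of_surjective g hg)
  epi_g := (ModuleCat.epi_iff_surjective _).2 (CharacterModule.dual_surjective_of_injective f hf)

lemma FD.ext_zero {d : ℕ} (h : FD R d A) (X : ModuleCat.{u} R) (j : ℕ) (hj : d < j) :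
    Subsingleton (Abelian.Ext X (dl R A) j) :=
  HasInjectiveDimensionLT.subsingleton (hX := h) (dl R A) (d+1) j hj X

lemma FD.mono {d e : ℕ} (h : FD R d A) (hde : d ≤ e) : FD R e A :=
  have : HasInjectiveDimensionLT (dl R A) (d+1) := h
  hasInjectiveDimensionLT_of_ge (dl R A) (d+1) (e+1) (by omega)

lemma FD.of_equiv {d : ℕ} (h : FD R d A) (e : A ≃ₗ[R] B) : FD R d B :=
  have : HasInjectiveDimensionLT (dl R A) (d+1) := h
  hasInjectiveDimensionLT_of_iso (CharacterModule.congr e).toModuleIso (d+1)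

lemma FD_zero_iff : FD R 0 A ↔ Module.Flat R A := by
  rw [Module.Flat.iff_characterModule_injective, FD]
  rw [Module.injective_iff_injective_object]
  exact injective_iff_hasInjectiveDimensionLT_one.symm

lemma FD_of_subsingleton [Subsingleton A] (d : ℕ) : FD R d A := by
  have : FD R 0 A := FD_zero_iff.2 inferInstance
  exact this.mono (Nat.zero_le _)

lemma FD.third {d : ℕ} (f : A →ₗ[R] B) (g : B →ₗ[R] C) (hf : Function.Injective f)
    (hg : Function.Surjective g) (hfg : Function.Exact f g) (hA : FD R d A)
    (hB : FD R (d+1) B) : FD R (d+1) C :=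
  (dS_shortExact f g hf hg hfg).hasInjectiveDimensionLT_X₁ (d+1) hA hB

lemma FD.first {d : ℕ} (f : A →ₗ[R] B) (g : B →ₗ[R] C) (hf : Function.Injective f)
    (hg : Function.Surjective g) (hfg : Function.Exact f g) (hB : FD R d B)
    (hC : FD R (d+1) C) : FD R d A :=
  (dS_shortExact f g hf hg hfg).hasInjectiveDimensionLT_X₃ (d+1) hB hC

lemma FD.mid {d : ℕ} (f : A →ₗ[R] B) (g : B →ₗ[R] C) (hf : Function.Injective f)
    (hg : Function.Surjective g) (hfg : Function.Exact f g) (hA : FD R d A)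
    (hC : FD R d C) : FD R d B :=
  (dS_shortExact f g hf hg hfg).hasInjectiveDimensionLT_X₂ (d+1) hC hA

/-- vanishing of `Ext^j(X, N^+)` -/
def EZ (X : ModuleCat.{u} R) (j : ℕ) (N : Type u) [AddCommGroup N] [Module R N] : Prop :=
  ∀ x : Abelian.Ext X (dl R N) j, x = 0

variable {X : ModuleCat.{u} R}

lemma EZ.of_equiv {j : ℕ} (h : EZ X j A) (e : A ≃ₗ[R] B) : EZ X j B := by
  intro x
  have i : dl R A ≅ dl R B := (CharacterModule.congr e).toModuleIso
  have h1 := h (x.comp (Ext.mk₀ i.inv) (add_zero _))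
  have : (x.comp (Ext.mk₀ i.inv) (add_zero _)).comp (Ext.mk₀ i.hom) (add_zero _) = x := by
    rw [Ext.comp_assoc_of_second_deg_zero]; simp
  rw [← this, h1, Ext.zero_comp]

lemma EZ.mid {j : ℕ} (f : A →ₗ[R] B) (g : B →ₗ[R] C) (hf : Function.Injective f)
    (hg : Function.Surjective g) (hfg : Function.Exact f g) (hA : EZ X j A)
    (hC : EZ X j C) : EZ X j B := by
  intro x
  obtain ⟨y, rfl⟩ := Ext.covariant_sequence_exact₂ X (dS_shortExact f g hf hg hfg) x (hA _)
  exact (congrArg (fun z => Ext.comp z _ _) (hC y)).trans (Ext.zero_comp _ _ _ _ _)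

lemma EZ.first {j : ℕ} (f : A →ₗ[R] B) (g : B →ₗ[R] C) (hf : Function.Injective f)
    (hg : Function.Surjective g) (hfg : Function.Exact f g) (hB : EZ X j B)
    (hC : EZ X (j+1) C) : EZ X j A := by
  intro x
  obtain ⟨y, rfl⟩ := Ext.covariant_sequence_exact₃ X (dS_shortExact f g hf hg hfg) x rfl (hC _)
  exact (congrArg (fun z => Ext.comp z _ _) (hB y)).trans (Ext.zero_comp _ _ _ _ _)

/-- The contravariant Hom surjectivity obtained from vanishing of the first Ext. -/
lemma EZ.lift (f : A →ₗ[R] B) (g : B →ₗ[R] C) (hf : Function.Injective f)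
    (hg : Function.Surjective g) (hfg : Function.Exact f g) (hC : EZ X 1 C)
    (φ : X →ₗ[R] CharacterModule A) :
    ∃ ψ : X →ₗ[R] CharacterModule B, (CharacterModule.dual f).comp ψ = φ := by
  obtain ⟨y, hy⟩ := Ext.covariant_sequence_exact₃ X (dS_shortExact f g hf hg hfg)
    (Ext.mk₀ (ModuleCat.ofHom φ)) (n₁ := 1) rfl (hC _)
  obtain ⟨y, rfl⟩ := Ext.addEquiv₀.symm.surjective y
  refine ⟨y.hom, ?_⟩
  change (Ext.mk₀ y).comp (Ext.mk₀ _) (add_zero _) = _ at hy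
  rw [Ext.mk₀_comp_mk₀] at hy
  have := (Ext.mk₀_bijective _ _).1 hy
  exact congrArg ModuleCat.Hom.hom this

lemma EZ.localized [IsLocalRing R] (x : R) (hx : ∀ y : X, x • y = 0) (j : ℕ)
    (hb : Function.Bijective (fun a : A => x • a)) : EZ X j A := by
  intro e
  have h1 : x • e = 0 := by
    have : x • e = (Ext.mk₀ (x • 𝟙 X)).comp e (zero_add _) := by
      rw [Ext.mk₀_smul, Ext.smul_comp]; simp
    rw [this]
    have : x • 𝟙 X = 0 := by ext y; exact hx y
    rw [this]; simp
  rw [Ext.smul_eq_comp_mk₀] at h1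
  have hbij : Function.Bijective (CharacterModule.dual (LinearMap.lsmul R A x)) :=
    CharacterModule.dual_bijective_iff_bijective.2 hb
  let i : dl R A ≅ dl R A := (LinearEquiv.ofBijective _ hbij).toModuleIso
  have hi : i.hom = x • 𝟙 _ := by
    ext c
    rfl
  rw [← hi] at h1
  have : (e.comp (Ext.mk₀ i.hom) (add_zero _)).comp (Ext.mk₀ i.inv) (add_zero _) = e := by
    rw [Ext.comp_assoc_of_second_deg_zero]; simp
  rw [← this, h1, Ext.zero_comp]

lemma EZ_of_subsingleton [Subsingleton A] (j : ℕ) : EZ X j A := by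
  intro x
  have : Limits.IsZero (dl R A) := by
    apply ModuleCat.isZero_of_iff_subsingleton.2
    constructor; intro a b; ext y; rw [Subsingleton.elim y 0, map_zero, map_zero]
  have h := x.comp_mk₀_id
  rw [(this.eq_of_src (𝟙 _) 0)] at h
  rw [← h]; simp

end dual
end FLC

namespace FLC
open Abelian

section resdim
variable {R : Type u} [CommRing R]

lemma FD_of_ResDimLE : ∀ (d : ℕ) (N : ModuleCat.{u} R),
    ResDimLE R (fun N => Module.Flat R N) d N → FD R d N
  | 0, N, h => FD_zero_iff.2 h
  | d+1, N, h => by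
    rcases h with h | ⟨X, f, hX, hf, h⟩
    · exact (FD_of_ResDimLE d N h).mono (Nat.le_succ d)
    · exact FD.third (LinearMap.ker f).subtype f Subtype.val_injective hf
        (LinearMap.exact_subtype_ker_map f) (FD_of_ResDimLE d _ h)
        ((FD_zero_iff.2 hX).mono (Nat.zero_le _))

lemma ResDimLE_of_FD : ∀ (d : ℕ) (N : ModuleCat.{u} R),
    FD R d N → ResDimLE R (fun N => Module.Flat R N) d N
  | 0, N, h => FD_zero_iff.1 h
  | d+1, N, h => by
    refine Or.inr ⟨ModuleCat.of R (N →₀ R), Finsupp.linearCombination R (id : N → N), ?_,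
      Finsupp.linearCombination_id_surjective R N, ResDimLE_of_FD d _ ?_⟩
    · change Module.Flat R (N →₀ R); infer_instance
    · refine FD.first (LinearMap.ker (Finsupp.linearCombination R (id : N → N))).subtype
        (Finsupp.linearCombination R (id : N → N)) Subtype.val_injective
        (Finsupp.linearCombination_id_surjective R N)
        (LinearMap.exact_subtype_ker_map _) ?_ h
      have : FD R 0 (N →₀ R) := FD_zero_iff.2 inferInstance
      exact this.mono (Nat.zero_le _)

lemma ResDimLE_mono' {P Q : ModuleCat.{u} R → Prop} (h : ∀ N, P N → Q N) : ∀ (d : ℕ) (N : ModuleCat.{u} R),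
    ResDimLE R P d N → ResDimLE R Q d N
  | 0, N, hN => h N hN
  | d+1, N, hN => by
    rcases hN with hN | ⟨X, f, hX, hf, hN⟩
    · exact Or.inl (ResDimLE_mono' h d N hN)
    · exact Or.inr ⟨X, f, h X hX, hf, ResDimLE_mono' h d _ hN⟩

lemma ResDim_le {P : ModuleCat.{u} R → Prop} {d : ℕ} {N : ModuleCat.{u} R}
    (h : ResDimLE R P d N) : ResDim R P N ≤ d := sInf_le ⟨d, rfl, h⟩

lemma ResDim_eq {P : ModuleCat.{u} R → Prop} {N : ModuleCat.{u} R}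
    (h : ResDim R P N ≠ ⊤) : ∃ d : ℕ, ResDim R P N = d ∧ ResDimLE R P d N := by
  have hne : {n : ℕ∞ | ∃ k : ℕ, (k : ℕ∞) = n ∧ ResDimLE R P k N}.Nonempty := by
    by_contra hh
    rw [Set.not_nonempty_iff_eq_empty] at hh
    exact h (by rw [ResDim, hh, sInf_empty])
  obtain ⟨k, hk, hk'⟩ := csInf_mem hne
  exact ⟨k, hk.symm, hk'⟩

end resdim

section loc
variable {R : Type u} [CommRing R]

/-- localization at one element -/
abbrev Lz (x : R) (N : Type u) [AddCommGroup N] [Module R N] : Type u :=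
  LocalizedModule (Submonoid.powers x) N

variable {A B C : Type u} [AddCommGroup A] [Module R A] [AddCommGroup B] [Module R B]
  [AddCommGroup C] [Module R C]

/-- the structure map -/
noncomputable abbrev ι (x : R) (N : Type u) [AddCommGroup N] [Module R N] : N →ₗ[R] Lz x N :=
  LocalizedModule.mkLinearMap (Submonoid.powers x) N

/-- functoriality -/
noncomputable abbrev lz (x : R) (f : A →ₗ[R] B) : Lz x A →ₗ[R] Lz x B :=
  IsLocalizedModule.map (Submonoid.powers x) (ι x A) (ι x B) f

lemma lz_ι (x : R) (f : A →ₗ[R] B) (a : A) : lz x f (ι x A a) = ι x B (f a) :=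
  IsLocalizedModule.map_apply _ _ _ _ _

lemma lz_exact (x : R) (f : A →ₗ[R] B) (g : B →ₗ[R] C) (h : Function.Exact f g) :
    Function.Exact (lz x f) (lz x g) :=
  IsLocalizedModule.map_exact (Submonoid.powers x) (ι x A) (ι x B) (ι x C) f g h

lemma lz_inj (x : R) (f : A →ₗ[R] B) (h : Function.Injective f) :
    Function.Injective (lz x f) :=
  IsLocalizedModule.map_injective (Submonoid.powers x) (ι x A) (ι x B) f h

lemma lz_surj (x : R) (f : A →ₗ[R] B) (h : Function.Surjective f) :
    Function.Surjective (lz x f) :=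
  IsLocalizedModule.map_surjective (Submonoid.powers x) (ι x A) (ι x B) f h

lemma Lz_flat (x : R) [Module.Flat R A] : Module.Flat R (Lz x A) := by
  let e := (LocalizedModule.equivTensorProduct (Submonoid.powers x) A).restrictScalars R
  have : Module.Flat R (Localization (Submonoid.powers x)) := IsLocalization.flat _ (Submonoid.powers x)
  exact Module.Flat.of_linearEquiv e

lemma FD.localized (x : R) : ∀ (d : ℕ) (A : Type u) [AddCommGroup A] [Module R A] (_ : FD R d A),
    FD R d (Lz x A)
  | 0, A, _, _, h => by
    have := FD_zero_iff.1 h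
    exact FD_zero_iff.2 (Lz_flat x)
  | d+1, N, _, _, h => by
    let g := (Finsupp.linearCombination R (id : N → N))
    have hg : Function.Surjective g := Finsupp.linearCombination_id_surjective R N
    have hF : FD R 0 (N →₀ R) := FD_zero_iff.2 inferInstance
    have h1 : FD R d (LinearMap.ker g) := FD.first (LinearMap.ker g).subtype
        g Subtype.val_injective hg
        (LinearMap.exact_subtype_ker_map _) (hF.mono (Nat.zero_le _)) h
    have h2 := FD.localized x d _ h1
    have h3 := FD.localized x 0 _ hF
    exact FD.third (lz x (LinearMap.ker g).subtype) (lz x g) (lz_inj x _ Subtype.val_injective)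
      (lz_surj x _ hg) (lz_exact x _ _ (LinearMap.exact_subtype_ker_map _)) h2
      (h3.mono (Nat.zero_le _))

lemma Lz_bij (x : R) : Function.Bijective (fun a : Lz x A => x • a) := by
  have := IsLocalizedModule.map_units (S := Submonoid.powers x) (ι x A) ⟨x, Submonoid.mem_powers x⟩
  exact (Module.End.isUnit_iff _).1 this

lemma FD.prod {d : ℕ} (hA : FD R d A) (hB : FD R d B) : FD R d (A × B) :=
  FD.mid (LinearMap.inl R A B) (LinearMap.snd R A B) LinearMap.inl_injective
    LinearMap.snd_surjective Function.Exact.inl_snd hA hB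

lemma EZ.prod {X : ModuleCat.{u} R} {d : ℕ} (hA : EZ X d A) (hB : EZ X d B) : EZ X d (A × B) :=
  EZ.mid (LinearMap.inl R A B) (LinearMap.snd R A B) LinearMap.inl_injective
    LinearMap.snd_surjective Function.Exact.inl_snd hA hB

end loc

section fg
variable {R : Type u} [CommRing R] [IsLocalRing R]

/-- the residue field as an object -/
noncomputable abbrev kk (R : Type u) [CommRing R] [IsLocalRing R] : ModuleCat.{u} R :=
  ModuleCat.of R (ResidueField R)

lemma subsingleton_of_EZ_zero (M : Type u) [AddCommGroup M] [Module R M] [Module.Finite R M]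
    (h : EZ (kk R) 0 M) : Subsingleton M := by
  have h1 : ∀ φ : ResidueField R →ₗ[R] CharacterModule M, φ = 0 := by
    intro φ
    have := h (Ext.mk₀ (ModuleCat.ofHom φ))
    have h2 := (Ext.mk₀_bijective (kk R) (dl R M)).1 (this.trans (Ext.mk₀_zero _ _).symm)
    exact congrArg ModuleCat.Hom.hom h2
  have h3 : Subsingleton (TensorProduct R (ResidueField R) M) := by
    refine subsingleton_of_forall_eq 0 fun a => CharacterModule.eq_zero_of_character_apply fun c => ?_
    have := h1 (CharacterModule.homEquiv.symm c)
    have hc : c = 0 := by simpa using this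
    rw [hc]; rfl
  exact IsLocalRing.subsingleton_tensorProduct.1 h3

lemma proj_of_EZ [IsNoetherianRing R] : ∀ (d : ℕ) (M : ModuleCat.{u} R) (_ : Module.Finite R M)
    (_ : ∀ j, d < j → EZ (kk R) j M), ResDimLE R (fun N => Module.Projective R N) d M
  | 0, M, _, h => by
    obtain ⟨n, g, hg⟩ := Module.Finite.exists_fin' R M
    let K := LinearMap.ker g
    have : Module.Free R M := by
      refine Module.free_of_lTensor_residueField_injective K.subtype g hg
        (LinearMap.exact_subtype_ker_map g) ?_
      rw [← CharacterModule.dual_surjective_iff_injective]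
      intro c
      obtain ⟨ψ, hψ⟩ := EZ.lift (X := kk R) K.subtype g Subtype.val_injective hg
        (LinearMap.exact_subtype_ker_map g) (h 1 Nat.one_pos) (CharacterModule.homEquiv.symm c)
      refine ⟨CharacterModule.homEquiv ψ, ?_⟩
      have h2 : c = CharacterModule.homEquiv ((CharacterModule.dual K.subtype).comp ψ) := by
        rw [hψ]; simp
      rw [h2]
      ext t
      induction t with
      | zero => exact (map_zero _).trans (map_zero _).symm
      | tmul a b => rfl
      | add a b ha hb => rw [map_add, map_add, ha, hb]
    change Module.Projective R M
    infer_instance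
  | d+1, M, _, h => by
    obtain ⟨n, g, hg⟩ := Module.Finite.exists_fin' R M
    refine Or.inr ⟨ModuleCat.of R (Fin n → R), g, ?_, hg, proj_of_EZ d _ ?_ ?_⟩
    · change Module.Projective R (Fin n → R); infer_instance
    · change Module.Finite R (LinearMap.ker g); infer_instance
    · intro j hj
      refine EZ.first (LinearMap.ker g).subtype g Subtype.val_injective hg
        (LinearMap.exact_subtype_ker_map g) ?_ (h (j+1) (by omega))
      have hF : FD R 0 (Fin n → R) := FD_zero_iff.2 inferInstance
      intro x
      have := hF.ext_zero (kk R) j (by omega)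
      exact Subsingleton.elim _ _

end fg

section cplx
variable {R : Type u} [CommRing R]
variable (X : ℕ → ModuleCat.{u} R) (δ : ∀ i, X i →ₗ[R] X (i+1))
  (n : ℕ) (s : ℕ) (H : Type u) [AddCommGroup H] [Module R H]

/-- boundaries -/
def Bd : ∀ i, Submodule R (X i)
  | 0 => ⊥
  | i+1 => LinearMap.range (δ i)

/-- Data of a bounded complex with cohomology `H` concentrated in degree `n`. -/
structure Conc : Prop where
  zero : ∀ i, s < i → Subsingleton (X i)
  exact : ∀ i, i ≠ n → LinearMap.ker (δ i) = Bd X δ i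
  coh : ∃ g : LinearMap.ker (δ n) →ₗ[R] H, Function.Surjective g ∧
    ∀ z : LinearMap.ker (δ n), g z = 0 ↔ (z : X n) ∈ Bd X δ n
  le : Bd X δ n ≤ LinearMap.ker (δ n)

variable {X δ n s H}

lemma ses_ZB (i : ℕ) : Function.Exact (LinearMap.ker (δ i)).subtype (δ i).rangeRestrict := by
  intro x
  simp [Subtype.ext_iff]

lemma Conc.FD_Z (h : Conc X δ n s H) {d : ℕ} (hd : ∀ i, FD R d (X i)) :
    ∀ (t : ℕ) (i : ℕ), n ≤ i → s < i + t → FD R d (LinearMap.ker (δ i))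
  | 0, i, _, hi => by
    have := h.zero i (by omega)
    exact FD_of_subsingleton d
  | t+1, i, hn, hi => by
    have h1 := h.FD_Z hd t (i+1) (by omega) (by omega)
    rw [h.exact (i+1) (by omega)] at h1
    exact FD.first (LinearMap.ker (δ i)).subtype (δ i).rangeRestrict Subtype.val_injective
      (LinearMap.surjective_rangeRestrict _) (ses_ZB i) (hd i) (h1.mono (Nat.le_succ d))

lemma Conc.FD_B (h : Conc X δ n s H) {d : ℕ} (hd : ∀ i, FD R d (X i)) :
    ∀ (i : ℕ), i + 1 ≤ n → FD R (d+i) (Bd X δ (i+1))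
  | 0, hn => by
    have h1 := h.exact 0 (by omega)
    have : Function.Injective (δ 0) := LinearMap.ker_eq_bot.1 h1
    exact (hd 0).of_equiv (LinearEquiv.ofInjective _ this)
  | i+1, hn => by
    have h1 := h.FD_B hd i (by omega)
    rw [← h.exact (i+1) (by omega)] at h1
    exact FD.third (LinearMap.ker (δ (i+1))).subtype (δ (i+1)).rangeRestrict Subtype.val_injective
      (LinearMap.surjective_rangeRestrict _) (ses_ZB (i+1)) h1 ((hd (i+1)).mono (Nat.le_add_right d (i+1)))

lemma Conc.ses (h : Conc X δ n s H) : ∃ g : LinearMap.ker (δ n) →ₗ[R] H, Function.Surjective g ∧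
    Function.Exact (Submodule.inclusion h.le) g := by
  obtain ⟨g, hg, hg'⟩ := h.coh
  refine ⟨g, hg, fun z => (hg' z).trans ?_⟩
  constructor
  · intro hz; exact ⟨⟨z, hz⟩, rfl⟩
  · rintro ⟨y, rfl⟩; exact y.2

lemma Conc.FD_H (h : Conc X δ n s H) {d : ℕ} (hd : ∀ i, FD R d (X i)) : FD R (d+n) H := by
  obtain ⟨g, hg, hg'⟩ := h.ses
  have hZ := h.FD_Z hd (s+1) n le_rfl (by omega)
  cases n with
  | zero =>
    refine hZ.of_equiv (LinearEquiv.ofBijective g ⟨?_, hg⟩)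
    rw [← LinearMap.ker_eq_bot, LinearMap.ker_eq_bot']
    intro z hz
    obtain ⟨⟨y, hy⟩, rfl⟩ := (hg' z).1 hz
    have : y = 0 := hy
    subst this; rfl
  | succ n =>
    exact FD.third _ g (Submodule.inclusion_injective _) hg hg' (h.FD_B hd n le_rfl)
      (hZ.mono (Nat.le_add_right d (n+1)))

variable {k : ModuleCat.{u} R}

lemma Conc.EZ_Z (h : Conc X δ n s H) (hd : ∀ i j, EZ k j (X (i+1))) :
    ∀ (t : ℕ) (i : ℕ), n ≤ i + 1 → s < i + 1 + t → ∀ j, EZ k j (LinearMap.ker (δ (i+1)))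
  | 0, i, _, hi => fun j => by
    have := h.zero (i+1) (by omega)
    exact EZ_of_subsingleton j
  | t+1, i, hn, hi => fun j => by
    have h1 := h.EZ_Z hd t (i+1) (by omega) (by omega) (j+1)
    rw [h.exact (i+1+1) (by omega)] at h1
    exact EZ.first (LinearMap.ker (δ (i+1))).subtype (δ (i+1)).rangeRestrict Subtype.val_injective
      (LinearMap.surjective_rangeRestrict _) (ses_ZB (i+1)) (hd i j) h1

lemma Conc.EZ_B (h : Conc X δ n s H) (hd : ∀ i j, EZ k j (X (i+1))) (j : ℕ) :
    ∀ (i : ℕ), i + 1 ≤ n → EZ k (j+i) (Bd X δ (i+1)) → EZ k j (X 0)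
  | 0, hn => fun hB => by
    have h1 := h.exact 0 (by omega)
    have : Function.Injective (δ 0) := LinearMap.ker_eq_bot.1 h1
    exact hB.of_equiv (LinearEquiv.ofInjective _ this).symm
  | i+1, hn => fun hB => by
    refine h.EZ_B hd j i (by omega) ?_
    rw [← h.exact (i+1) (by omega)]
    exact EZ.first (LinearMap.ker (δ (i+1))).subtype (δ (i+1)).rangeRestrict Subtype.val_injective
      (LinearMap.surjective_rangeRestrict _) (ses_ZB (i+1)) (hd i _) hB

lemma Conc.EZ_H (h : Conc X δ n s H) (hd : ∀ i j, EZ k j (X (i+1))) (j : ℕ)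
    (hH : EZ k (j+n) H) : EZ k j (X 0) := by
  obtain ⟨g, hg, hg'⟩ := h.ses
  cases n with
  | zero =>
    have hZ := h.EZ_Z hd s 0 (by omega) (by omega) j
    rw [h.exact 1 (by omega)] at hZ
    refine EZ.mid (LinearMap.ker (δ 0)).subtype (δ 0).rangeRestrict Subtype.val_injective
      (LinearMap.surjective_rangeRestrict _) (ses_ZB 0) ?_ hZ
    refine EZ.of_equiv hH (LinearEquiv.ofBijective g ⟨?_, hg⟩).symm
    rw [← LinearMap.ker_eq_bot, LinearMap.ker_eq_bot']
    intro z hz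
    obtain ⟨⟨y, hy⟩, rfl⟩ := (hg' z).1 hz
    have : y = 0 := hy
    subst this; rfl
  | succ n =>
    have hZ := h.EZ_Z hd (s+1) n (by omega) (by omega)
    refine h.EZ_B hd j n le_rfl ?_
    exact EZ.first _ g (Submodule.inclusion_injective _) hg hg' (hZ _) hH

end cplx

/-- Main reduction. -/
theorem main_of_conc {R : Type u} [CommRing R] [IsNoetherianRing R] [IsLocalRing R]
    (M : Type u) [AddCommGroup M] [Module R M] (n s : ℕ) (H : Type u) [AddCommGroup H] [Module R H]
    (X : ℕ → ModuleCat.{u} R) (δ : ∀ i, X i →ₗ[R] X (i+1)) (h : Conc X δ n s H)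
    (e : X 0 ≃ₗ[R] M) (hX : ∀ i j, EZ (kk R) j (X (i+1)))
    (hF : ∀ d, FD R d M → ∀ i, FD R d (X i)) :
    (flatDim R M ≠ ⊤ → flatDim R H ≠ ⊤) ∧
    (Module.Finite R M → flatDim R H ≠ ⊤ → flatDim R M ≠ ⊤) ∧
    (Module.Finite R M → Nontrivial M →
      flatDim R H = flatDim R M + n ∧
      flatDim R H = projDim R M + n) := by
  have up : ∀ d : ℕ, FD R d M → flatDim R H ≤ (d + n : ℕ) := fun d hd =>
    ResDim_le (ResDimLE_of_FD (d+n) (ModuleCat.of R H) (h.FD_H (hF d hd)))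
  have lo : ∀ d : ℕ, FD R d H → ∀ j, d < j + n → EZ (kk R) j M := fun d hd j hj => by
    refine EZ.of_equiv (h.EZ_H hX j ?_) e
    have := hd.ext_zero (kk R) (j+n) hj
    exact fun x => Subsingleton.elim _ _
  have fp : flatDim R M ≤ projDim R M := by
    by_cases hp : projDim R M = ⊤
    · rw [hp]; exact le_top
    · obtain ⟨d, hd, hd'⟩ := ResDim_eq hp
      rw [projDim, hd]
      exact ResDim_le (ResDimLE_mono' (fun N hN => by have := hN; exact Module.Flat.of_projective) d _ hd')
  have p1 : flatDim R M ≠ ⊤ → flatDim R H ≤ flatDim R M + n := by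
    intro hM
    obtain ⟨d, hd, hd'⟩ := ResDim_eq hM
    have := up d (FD_of_ResDimLE d _ hd')
    rw [flatDim, flatDim, hd]
    exact_mod_cast this
  refine ⟨fun hM hH => ?_, fun hfin hH => ?_, fun hfin hnt => ?_⟩
  · have := p1 hM
    rw [hH, top_le_iff] at this
    exact (WithTop.add_ne_top.2 ⟨hM, WithTop.coe_ne_top⟩) this
  · obtain ⟨d, hd, hd'⟩ := ResDim_eq hH
    have := proj_of_EZ d (ModuleCat.of R M) hfin
      (fun j hj => lo d (FD_of_ResDimLE d _ hd') j (by omega))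
    intro hM
    have h2 := ResDim_le this
    have h3 := fp.trans h2
    rw [hM] at h3
    exact absurd h3 (by simp)
  · have key : projDim R M + n ≤ flatDim R H := by
      by_cases hH : flatDim R H = ⊤
      · rw [hH]; exact le_top
      obtain ⟨d, hd, hd'⟩ := ResDim_eq hH
      have hlo := lo d (FD_of_ResDimLE d _ hd')
      have hnd : n ≤ d := by
        by_contra hlt
        have := subsingleton_of_EZ_zero M (hlo 0 (by omega))
        exact not_subsingleton M this
      have := ResDim_le (proj_of_EZ (d-n) (ModuleCat.of R M) hfin (fun j hj => hlo j (by omega)))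
      rw [flatDim, hd]
      calc projDim R M + n ≤ ((d - n : ℕ) : ℕ∞) + n := by gcongr; exact this
        _ = d := by rw [← Nat.cast_add, Nat.sub_add_cancel hnd]
    have key2 : flatDim R H ≤ flatDim R M + n := by
      by_cases hM : flatDim R M = ⊤
      · rw [hM]; simp
      · exact p1 hM
    have key3 : flatDim R M + n ≤ projDim R M + n := by gcongr
    exact ⟨le_antisymm key2 (key3.trans key), le_antisymm (key2.trans key3) key⟩

end FLC

namespace FLC
section derived
open Limits HomologicalComplex
universe v₁ u₁ v₂ u₂
variable {C : Type u₁} [Category.{v₁} C] [Abelian C] [EnoughProjectives C]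
  {D : Type u₂} [Category.{v₂} D] [Abelian D]
  {F G H : C ⥤ D} [F.Additive] [G.Additive] [H.Additive]

/-- the short complex of chain complexes obtained by applying natural transformations -/
noncomputable abbrev scx (α : F ⟶ G) (β : G ⟶ H) (w : α ≫ β = 0) (K : ChainComplex C ℕ) :
    ShortComplex (ChainComplex D ℕ) :=
  ShortComplex.mk ((NatTrans.mapHomologicalComplex α _).app K)
    ((NatTrans.mapHomologicalComplex β _).app K) (by
      ext i
      exact congr_app w (K.X i))

/-- functoriality of `scx` -/
noncomputable abbrev scxMap (α : F ⟶ G) (β : G ⟶ H) (w : α ≫ β = 0) {K L : ChainComplex C ℕ}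
    (φ : K ⟶ L) : scx α β w K ⟶ scx α β w L where
  τ₁ := (F.mapHomologicalComplex _).map φ
  τ₂ := (G.mapHomologicalComplex _).map φ
  τ₃ := (H.mapHomologicalComplex _).map φ
  comm₁₂ := ((NatTrans.mapHomologicalComplex α _).naturality φ)
  comm₂₃ := ((NatTrans.mapHomologicalComplex β _).naturality φ)

variable (α : F ⟶ G) (β : G ⟶ H) (w : α ≫ β = 0)
  (hse : ∀ P : C, Projective P → (ShortComplex.mk (α.app P) (β.app P) (congr_app w P)).ShortExact)

lemma scx_shortExact
    (hse : ∀ P : C, Projective P → (ShortComplex.mk (α.app P) (β.app P) (congr_app w P)).ShortExact)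
    {A : C} (P : ProjectiveResolution A) :
    (scx α β w P.complex).ShortExact :=
  HomologicalComplex.shortExact_of_degreewise_shortExact _ (fun i => hse (P.complex.X i)
    (P.projective i))

/-- left derived functors via a resolution, in `homology` form -/
noncomputable def ldi {A : C} (P : ProjectiveResolution A) (F : C ⥤ D) [F.Additive] (i : ℕ) :
    (F.leftDerived i).obj A ≅ ((F.mapHomologicalComplex _).obj P.complex).homology i :=
  P.isoLeftDerivedObj F i

lemma ldi_nat {A B : C} (f : A ⟶ B) (P : ProjectiveResolution A) (Q : ProjectiveResolution B)
    (F : C ⥤ D) [F.Additive] (i : ℕ) :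
    (F.leftDerived i).map f ≫ (ldi Q F i).hom = (ldi P F i).hom ≫
      homologyMap ((F.mapHomologicalComplex _).map (ProjectiveResolution.lift f P Q)) i := by
  have comm : (ProjectiveResolution.lift f P Q).f 0 ≫ Q.π.f 0 = P.π.f 0 ≫ f := by
    rw [← HomologicalComplex.comp_f, ProjectiveResolution.lift_commutes,
      HomologicalComplex.comp_f, ChainComplex.single₀_map_f_zero]
    rfl
  exact ProjectiveResolution.isoLeftDerivedObj_hom_naturality f P Q _ comm F i

lemma ldi_app {A : C} (P : ProjectiveResolution A) (i : ℕ) :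
    (NatTrans.leftDerived α i).app A ≫ (ldi P G i).hom = (ldi P F i).hom ≫
      homologyMap ((NatTrans.mapHomologicalComplex α _).app P.complex) i := by
  rw [← Iso.eq_comp_inv]
  exact (ProjectiveResolution.leftDerived_app_eq α P i).trans (Category.assoc _ _ _).symm

/-- the connecting map -/
noncomputable def ldd {A : C} (P : ProjectiveResolution A) (i : ℕ) :
    ((H.mapHomologicalComplex _).obj P.complex).homology (i+1) ⟶
      ((F.mapHomologicalComplex _).obj P.complex).homology i :=
  (scx_shortExact α β w hse P).δ (i+1) i rfl

lemma ldd_nat {A B : C} (f : A ⟶ B) (P : ProjectiveResolution A) (Q : ProjectiveResolution B)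
    (i : ℕ) :
    ldd α β w hse P i ≫ homologyMap ((F.mapHomologicalComplex _).map
        (ProjectiveResolution.lift f P Q)) i =
    homologyMap ((H.mapHomologicalComplex _).map (ProjectiveResolution.lift f P Q)) (i+1) ≫
      ldd α β w hse Q i :=
  HomologicalComplex.HomologySequence.δ_naturality (scxMap α β w (ProjectiveResolution.lift f P Q))
      (scx_shortExact α β w hse P) (scx_shortExact α β w hse Q) (i+1) i rfl

lemma ldd_comp {A : C} (P : ProjectiveResolution A) (i : ℕ) : ldd α β w hse P i ≫
    homologyMap ((NatTrans.mapHomologicalComplex α _).app P.complex) i = 0 :=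
  (scx_shortExact α β w hse P).δ_comp (i+1) i rfl

lemma ldd_exact {A : C} (P : ProjectiveResolution A) (i : ℕ) :
    (ShortComplex.mk _ _ (ldd_comp α β w hse P i)).Exact :=
  (scx_shortExact α β w hse P).homology_exact₁ (i+1) i rfl

lemma ldd_mono {A : C} (P : ProjectiveResolution A) (i : ℕ)
    (hz : IsZero (((G.mapHomologicalComplex _).obj P.complex).homology (i+1))) :
    Mono (ldd α β w hse P i) :=
  (scx_shortExact α β w hse P).mono_δ _ _ _ hz

/-- the connecting transformation of left derived functors -/
noncomputable def dconn (i : ℕ) : H.leftDerived (i+1) ⟶ F.leftDerived i where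
  app A := (ldi (projectiveResolution A) H (i+1)).hom ≫
    ldd α β w hse (projectiveResolution A) i ≫ (ldi (projectiveResolution A) F i).inv
  naturality A B f := by
    rw [← cancel_mono (ldi (projectiveResolution B) F i).hom]
    simp only [Category.assoc, Iso.inv_hom_id, Category.comp_id]
    rw [ldi_nat f (projectiveResolution A), Iso.inv_hom_id_assoc, ldd_nat,
      ← Category.assoc, ldi_nat f (projectiveResolution A), Category.assoc]

lemma dconn_comp (i : ℕ) (A : C) :
    (dconn α β w hse i).app A ≫ (NatTrans.leftDerived α i).app A = 0 := by
  rw [← cancel_mono (ldi (projectiveResolution A) G i).hom]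
  simp only [dconn, Category.assoc, Limits.zero_comp]
  rw [ldi_app, Iso.inv_hom_id_assoc, ldd_comp, Limits.comp_zero]

lemma dconn_exact (i : ℕ) (A : C) :
    (ShortComplex.mk _ _ (dconn_comp α β w hse i A)).Exact := by
  refine (ShortComplex.exact_iff_of_iso (ShortComplex.isoMk
    (ldi (projectiveResolution A) H (i+1))
    (ldi (projectiveResolution A) F i)
    (ldi (projectiveResolution A) G i) ?_ ?_)).2 (ldd_exact α β w hse (projectiveResolution A) i)
  · simp [dconn]
  · exact (ldi_app _ _ _).symm

lemma dconn_mono (i : ℕ) (A : C) (hz : IsZero ((G.leftDerived (i+1)).obj A)) :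
    Mono ((dconn α β w hse i).app A) := by
  have h1 := ldd_mono α β w hse (projectiveResolution A) i
      (hz.of_iso (ldi (projectiveResolution A) G (i+1)).symm)
  dsimp only [dconn]
  infer_instance

end derived
end FLC

namespace FLC
section colim
open Limits
variable {R : Type u} [CommRing R] {J : Type} [SmallCategory J] [IsFiltered J]

instance : PreservesColimitsOfShape J (forget (ModuleCat.{u} R)) :=
  have := preservesFilteredColimitsOfSize_shrink.{0,u,0,u} (forget (ModuleCat.{u} R))
  PreservesFilteredColimitsOfSize.preserves_filtered_colimits J

variable {F G H : J ⥤ ModuleCat.{u} R} (a : F ⟶ G) (b : G ⟶ H)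

lemma colim_ι_map (j : J) (x : F.obj j) :
    (colimMap a).hom ((colimit.ι F j).hom x) = (colimit.ι G j).hom ((a.app j).hom x) := by
  have := ConcreteCategory.congr_hom (ι_colimMap a j) x
  exact this

lemma colim_surj (h : ∀ j, Function.Surjective (b.app j).hom) :
    Function.Surjective (colimMap b).hom := by
  intro y
  obtain ⟨j, z, rfl⟩ := Concrete.colimit_exists_rep H y
  obtain ⟨x, rfl⟩ := h j z
  exact ⟨_, colim_ι_map b j x⟩

lemma colim_exact (h : ∀ j, Function.Exact (a.app j).hom (b.app j).hom) :
    Function.Exact (colimMap a).hom (colimMap b).hom := by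
  intro y
  constructor
  · intro hy
    obtain ⟨j, z, rfl⟩ := Concrete.colimit_exists_rep G y
    erw [colim_ι_map] at hy
    obtain ⟨k, f, hf⟩ := Concrete.colimit_rep_eq_zero (F := H) (hx := hy)
    have h1 : (b.app k).hom ((G.map f).hom z) = 0 := by
      rw [← hf]
      exact ConcreteCategory.congr_hom (b.naturality f) z
    obtain ⟨x, hx⟩ := (h k _).1 h1
    refine ⟨(colimit.ι F k).hom x, ?_⟩
    rw [colim_ι_map, hx]
    exact ConcreteCategory.congr_hom (colimit.w G f) z
  · rintro ⟨x, rfl⟩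
    obtain ⟨j, z, rfl⟩ := Concrete.colimit_exists_rep F x
    erw [colim_ι_map, colim_ι_map, (h j _).2 ⟨z, rfl⟩, map_zero]

lemma colim_inj (h : ∀ j, Function.Injective (b.app j).hom) :
    Function.Injective (colimMap b).hom := by
  rw [injective_iff_map_eq_zero]
  intro y hy
  obtain ⟨j, z, rfl⟩ := Concrete.colimit_exists_rep G y
  erw [colim_ι_map] at hy
  obtain ⟨k, f, hf⟩ := Concrete.colimit_rep_eq_zero (F := H) (hx := hy)
  have h1 : (b.app k).hom ((G.map f).hom z) = 0 := by
    rw [← hf]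
    exact ConcreteCategory.congr_hom (b.naturality f) z
  have h2 := (injective_iff_map_eq_zero _).1 (h k) _ h1
  have h3 := ConcreteCategory.congr_hom (colimit.w G f) z
  refine h3.symm.trans ?_
  refine (congrArg (colimit.ι G k).hom h2).trans (map_zero _)

end colim

section lc
open Limits Opposite
variable {R : Type u} [CommRing R]

/-- contravariant Hom into `M` -/
noncomputable abbrev hF (M : ModuleCat.{u} R) : ModuleCat.{u} R ⥤ (ModuleCat.{u} R)ᵒᵖ :=
  ((linearYoneda R (ModuleCat.{u} R)).obj M).rightOp

/-- induced map on contravariant Homs -/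
noncomputable abbrev hM {M N : ModuleCat.{u} R} (f : M ⟶ N) : hF N ⟶ hF M :=
  NatTrans.rightOp ((linearYoneda R (ModuleCat.{u} R)).map f)

/-- the tower `R / 𝔞^k` -/
noncomputable abbrev tow (𝔞 : Ideal R) : ℕᵒᵖ ⥤ ModuleCat.{u} R :=
  localCohomology.ringModIdeals (localCohomology.idealPowersDiagram 𝔞)

/-- the direct system of Ext modules -/
noncomputable abbrev ED (𝔞 : Ideal R) (i : ℕ) (M : ModuleCat.{u} R) :
    (ℕᵒᵖ)ᵒᵖ ⥤ ModuleCat.{u} R :=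
  (tow 𝔞).op ⋙ ((hF M).leftDerived i).leftOp

/-- functoriality of the direct system of Ext modules -/
noncomputable abbrev EDmap (𝔞 : Ideal R) (i : ℕ) {M N : ModuleCat.{u} R} (f : M ⟶ N) :
    ED 𝔞 i M ⟶ ED 𝔞 i N :=
  Functor.whiskerLeft _ (NatTrans.leftOp (NatTrans.leftDerived (hM f) i))

/-- local cohomology is the colimit of the system -/
noncomputable def lcIso (𝔞 : Ideal R) (i : ℕ) (M : ModuleCat.{u} R) :
    (localCohomology 𝔞 i).obj M ≅ colimit (ED 𝔞 i M) :=
  colimitObjIsoColimitCompEvaluation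
    (localCohomology.diagram (localCohomology.idealPowersDiagram 𝔞) i) M

end lc
end FLC

namespace FLC
section zero
open Limits HomologicalComplex
universe v₁ u₁ v₂ u₂
variable {C : Type u₁} [Category.{v₁} C] [Abelian C] [EnoughProjectives C]
  {D : Type u₂} [Category.{v₂} D] [Abelian D]
  {F G : C ⥤ D} [F.Additive] [G.Additive]

lemma fldz'_nat (α : F ⟶ G) {A : C} (P : ProjectiveResolution A) :
    opcyclesMap ((NatTrans.mapHomologicalComplex α _).app P.complex) 0 ≫
      P.fromLeftDerivedZero' G = P.fromLeftDerivedZero' F ≫ α.app A := by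
  rw [← cancel_epi (HomologicalComplex.pOpcycles _ _), HomologicalComplex.p_opcyclesMap_assoc]
  rw [ProjectiveResolution.pOpcycles_comp_fromLeftDerivedZero',
    ProjectiveResolution.pOpcycles_comp_fromLeftDerivedZero'_assoc]
  exact (α.naturality _).symm

lemma fldz_nat (α : F ⟶ G) (A : C) :
    (NatTrans.leftDerived α 0).app A ≫ G.fromLeftDerivedZero.app A =
      F.fromLeftDerivedZero.app A ≫ α.app A := by
  have e1 (F : C ⥤ D) [F.Additive] : F.fromLeftDerivedZero.app A =
      (ldi (projectiveResolution A) F 0).hom ≫ homologyι _ 0 ≫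
        (projectiveResolution A).fromLeftDerivedZero' F :=
    ProjectiveResolution.fromLeftDerivedZero_eq _ F
  rw [e1 F, e1 G, ← Category.assoc, ldi_app]
  simp only [Category.assoc]
  rw [← fldz'_nat, homologyι_naturality_assoc]
end zero

section lc2
open Limits Opposite
variable {R : Type u} [CommRing R]

instance (M : ModuleCat.{u} R) : PreservesFiniteColimits (hF M) := by
  have : PreservesFiniteLimits ((linearYoneda R (ModuleCat.{u} R)).obj M) := by
    have : PreservesFiniteLimits ((linearYoneda R (ModuleCat.{u} R)).obj M ⋙ forget _) :=
      inferInstanceAs (PreservesFiniteLimits (yoneda.obj M))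
    exact preservesFiniteLimits_of_reflects_of_preserves _ (forget _)
  exact preservesFiniteColimits_rightOp _

variable {S : ShortComplex (ModuleCat.{u} R)} (hS : S.ShortExact)

lemma hM_zero (S : ShortComplex (ModuleCat.{u} R)) : hM S.g ≫ hM S.f = 0 := by
  have h0 : (linearYoneda R (ModuleCat.{u} R)).map S.f ≫
      (linearYoneda R (ModuleCat.{u} R)).map S.g = 0 := by
    rw [← Functor.map_comp, S.zero]
    ext P x : 4
    exact (comp_zero : (x : P.unop ⟶ S.X₁) ≫ (0 : S.X₁ ⟶ S.X₃) = 0)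
  ext P : 2
  exact congrArg Quiver.Hom.op (congr_app h0 (op P))

lemma se_of (S : ShortComplex (ModuleCat.{u} R)) (h1 : Function.Exact S.f.hom S.g.hom)
    (h2 : Function.Injective S.f.hom) (h3 : Function.Surjective S.g.hom) : S.ShortExact where
  exact := (ShortComplex.ShortExact.moduleCat_exact_iff_function_exact S).2 h1
  mono_f := (ModuleCat.mono_iff_injective _).2 h2
  epi_g := (ModuleCat.epi_iff_surjective _).2 h3

lemma hM_se {S : ShortComplex (ModuleCat.{u} R)} (hS : S.ShortExact) (P : ModuleCat.{u} R)
    (hP : Projective P) : (ShortComplex.mk ((hM S.g).app P) ((hM S.f).app P)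
      (congr_app (hM_zero S) P)).ShortExact := by
  have := hS.mono_f
  have := hS.epi_g
  have hz (x : P ⟶ S.X₁) : (x ≫ S.f) ≫ S.g = 0 := by rw [Category.assoc, S.zero, comp_zero]
  apply ShortComplex.ShortExact.op (S := ShortComplex.mk
    (((linearYoneda R (ModuleCat.{u} R)).map S.f).app (op P))
    (((linearYoneda R (ModuleCat.{u} R)).map S.g).app (op P)) (by
      ext x : 2
      exact hz x))
  refine se_of _ ?_ ?_ ?_
  · intro x
    constructor
    · intro hx
      exact ⟨hS.exact.lift x hx, hS.exact.lift_f _ _⟩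
    · rintro ⟨y, rfl⟩
      exact hz y
  · intro x y hxy
    exact (cancel_mono S.f).1 hxy
  · intro x
    exact ⟨Projective.factorThru (x : P ⟶ S.X₃) S.g, Projective.factorThru_comp (x : P ⟶ S.X₃) S.g⟩

lemma ld_injective (I : ModuleCat.{u} R) [Injective I] (i : ℕ) (A : ModuleCat.{u} R) :
    IsZero (((hF I).leftDerived (i+1)).obj A) := by
  let P := projectiveResolution A
  refine IsZero.of_iso ?_ (ldi P (hF I) (i+1))
  rw [← HomologicalComplex.exactAt_iff_isZero_homology,
    HomologicalComplex.exactAt_iff' _ (i+1+1) (i+1) i (by simp) (by simp)]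
  have h1 : (P.complex.sc' (i+1+1) (i+1) i).Exact :=
    (HomologicalComplex.exactAt_iff' _ (i+1+1) (i+1) i (by simp) (by simp)).1
      (P.complex_exactAt_succ i)
  apply ShortComplex.Exact.op (S := ShortComplex.mk
    (((linearYoneda R (ModuleCat.{u} R)).obj I).map (P.complex.d (i+1) i).op)
    (((linearYoneda R (ModuleCat.{u} R)).obj I).map (P.complex.d (i+1+1) (i+1)).op) (by
      rw [← Functor.map_comp, ← op_comp, P.complex.d_comp_d, op_zero, Functor.map_zero]))
  rw [ShortComplex.ShortExact.moduleCat_exact_iff_function_exact]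
  intro x
  constructor
  · intro hx
    exact ⟨h1.descToInjective x hx, h1.comp_descToInjective x hx⟩
  · rintro ⟨y, rfl⟩
    have hz (y : P.complex.X i ⟶ I) : P.complex.d (i+1+1) (i+1) ≫ P.complex.d (i+1) i ≫ y = 0 := by
      rw [← Category.assoc, P.complex.d_comp_d, zero_comp]
    exact hz y

/-- the connecting map on the direct systems -/
noncomputable def EDconn (𝔞 : Ideal R) (i : ℕ) : ED 𝔞 i S.X₃ ⟶ ED 𝔞 (i+1) S.X₁ :=
  Functor.whiskerLeft _ (NatTrans.leftOp (dconn (hM S.g) (hM S.f) (hM_zero S) (hM_se hS) i))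

lemma ED_exact (𝔞 : Ideal R) (i : ℕ) (j) :
    Function.Exact ((EDmap 𝔞 i S.g).app j).hom ((EDconn hS 𝔞 i).app j).hom := by
  have := (dconn_exact (hM S.g) (hM S.f) (hM_zero S) (hM_se hS) i
    ((tow 𝔞).obj j.unop)).unop
  exact (ShortComplex.ShortExact.moduleCat_exact_iff_function_exact _).1 this

lemma ED_surj [Injective S.X₂] (𝔞 : Ideal R) (i : ℕ) (j) :
    Function.Surjective ((EDconn hS 𝔞 i).app j).hom := by
  rw [← ModuleCat.epi_iff_surjective]
  have := dconn_mono (hM S.g) (hM S.f) (hM_zero S) (hM_se hS) i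
    ((tow 𝔞).obj j.unop) (ld_injective _ _ _)
  exact unop_epi_of_mono ((dconn (hM S.g) (hM S.f) (hM_zero S) (hM_se hS) i).app
    ((tow 𝔞).obj j.unop))

/-- local cohomology of an injective vanishes in positive degrees -/
lemma ED_inj (𝔞 : Ideal R) (i : ℕ) (I : ModuleCat.{u} R) [Injective I] :
    Subsingleton (colimit (ED 𝔞 (i+1) I) : ModuleCat.{u} R) := by
  constructor
  intro x y
  have key : ∀ x : (colimit (ED 𝔞 (i+1) I) : ModuleCat.{u} R), x = 0 := by
    intro x
    obtain ⟨j, z, rfl⟩ := Concrete.colimit_exists_rep (ED 𝔞 (i+1) I) x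
    have : IsZero ((ED 𝔞 (i+1) I).obj j) := (ld_injective I i ((tow 𝔞).obj j.unop)).unop
    have := ModuleCat.subsingleton_of_isZero this
    rw [Subsingleton.elim z 0]
    exact map_zero _
  rw [key x, key y]

end lc2
end FLC

namespace FLC
section lc3
open Limits Opposite
variable {R : Type u} [CommRing R]

/-- the `𝔞`-torsion submodule -/
def Gam (𝔞 : Ideal R) (M : Type u) [AddCommGroup M] [Module R M] : Submodule R M where
  carrier := {m | ∃ k : ℕ, ∀ r ∈ 𝔞 ^ k, r • m = 0}
  zero_mem' := ⟨0, fun r _ => smul_zero r⟩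
  add_mem' := by
    rintro a b ⟨k, hk⟩ ⟨l, hl⟩
    refine ⟨k + l, fun r hr => ?_⟩
    rw [smul_add, hk r (Ideal.pow_le_pow_right (Nat.le_add_right k l) hr),
      hl r (Ideal.pow_le_pow_right (Nat.le_add_left l k) hr), add_zero]
  smul_mem' := by
    rintro c a ⟨k, hk⟩
    exact ⟨k, fun r hr => by rw [smul_comm, hk r hr, smul_zero]⟩

/-- the direct system of Hom modules -/
noncomputable abbrev HD (𝔞 : Ideal R) (M : ModuleCat.{u} R) : (ℕᵒᵖ)ᵒᵖ ⥤ ModuleCat.{u} R :=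
  (tow 𝔞).op ⋙ (hF M).leftOp

/-- functoriality of `HD` -/
noncomputable abbrev HDmap (𝔞 : Ideal R) {M N : ModuleCat.{u} R} (f : M ⟶ N) :
    HD 𝔞 M ⟶ HD 𝔞 N := Functor.whiskerLeft _ (NatTrans.leftOp (hM f))

/-- comparison of Hom and Ext in degree zero -/
noncomputable def th (𝔞 : Ideal R) (M : ModuleCat.{u} R) : HD 𝔞 M ⟶ ED 𝔞 0 M :=
  Functor.whiskerLeft _ (NatTrans.leftOp (hF M).fromLeftDerivedZero)

lemma th_nat (𝔞 : Ideal R) {M N : ModuleCat.{u} R} (f : M ⟶ N) :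
    th 𝔞 M ≫ EDmap 𝔞 0 f = HDmap 𝔞 f ≫ th 𝔞 N := by
  ext j : 2
  exact congrArg Quiver.Hom.unop (fldz_nat (hM f) ((tow 𝔞).obj j.unop))

lemma th_bij (𝔞 : Ideal R) (M : ModuleCat.{u} R) (j) :
    Function.Bijective ((th 𝔞 M).app j).hom := by
  have : IsIso ((th 𝔞 M).app j) := by
    change IsIso ((hF M).fromLeftDerivedZero.app ((tow 𝔞).obj j.unop)).unop
    infer_instance
  exact (asIso ((th 𝔞 M).app j)).toLinearEquiv.bijective

/-- the class of one -/
def uno (𝔞 : Ideal R) (j : ℕᵒᵖ) : (tow 𝔞).obj j :=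
  (Submodule.Quotient.mk (1 : R) : R ⧸ (localCohomology.idealPowersDiagram 𝔞).obj j)

lemma uno_gen (𝔞 : Ideal R) (j : ℕᵒᵖ) (x : (tow 𝔞).obj j) : ∃ r : R, x = r • uno 𝔞 j := by
  obtain ⟨r, rfl⟩ := Submodule.Quotient.mk_surjective
    ((localCohomology.idealPowersDiagram 𝔞).obj j) x
  refine ⟨r, ?_⟩
  have : (Submodule.Quotient.mk r : R ⧸ (localCohomology.idealPowersDiagram 𝔞).obj j) =
      r • Submodule.Quotient.mk (1 : R) := by
    rw [← Submodule.Quotient.mk_smul, smul_eq_mul, mul_one]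
  exact this

lemma uno_zero (𝔞 : Ideal R) (j : ℕᵒᵖ) (r : R) (hr : r ∈ 𝔞 ^ j.unop) : r • uno 𝔞 j = 0 := by
  have : r • (Submodule.Quotient.mk (1 : R) : R ⧸ (localCohomology.idealPowersDiagram 𝔞).obj j)
      = 0 := by
    rw [← Submodule.Quotient.mk_smul, smul_eq_mul, mul_one]
    exact (Submodule.Quotient.mk_eq_zero _).2 hr
  exact this

/-- evaluation at one, stagewise -/
noncomputable def ev1 (𝔞 : Ideal R) (M : ModuleCat.{u} R) (j : (ℕᵒᵖ)ᵒᵖ) : (HD 𝔞 M).obj j ⟶ M :=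
  ModuleCat.ofHom
    { toFun := fun (φ : (tow 𝔞).obj j.unop ⟶ M) => φ.hom (uno 𝔞 j.unop)
      map_add' := fun _ _ => rfl
      map_smul' := fun _ _ => rfl }

lemma ev1_apply (𝔞 : Ideal R) (M : ModuleCat.{u} R) (j : (ℕᵒᵖ)ᵒᵖ) (φ : (tow 𝔞).obj j.unop ⟶ M) :
    (ev1 𝔞 M j).hom φ = φ.hom (uno 𝔞 j.unop) := rfl

lemma ev1_nat (𝔞 : Ideal R) (M : ModuleCat.{u} R) {j k : (ℕᵒᵖ)ᵒᵖ} (f : j ⟶ k) :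
    (HD 𝔞 M).map f ≫ ev1 𝔞 M k = ev1 𝔞 M j := by
  ext φ : 2
  rfl

/-- evaluation at one, as a cocone -/
noncomputable def evc (𝔞 : Ideal R) (M : ModuleCat.{u} R) : Cocone (HD 𝔞 M) where
  pt := M
  ι :=
    { app := ev1 𝔞 M
      naturality := fun j k f => (ev1_nat 𝔞 M f).trans (Category.comp_id _).symm }

/-- evaluation at one -/
noncomputable def evo (𝔞 : Ideal R) (M : ModuleCat.{u} R) : colimit (HD 𝔞 M) ⟶ M :=
  colimit.desc (HD 𝔞 M) (evc 𝔞 M)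

lemma evo_ι (𝔞 : Ideal R) (M : ModuleCat.{u} R) (j : (ℕᵒᵖ)ᵒᵖ) (φ : (HD 𝔞 M).obj j) :
    (evo 𝔞 M).hom ((colimit.ι (HD 𝔞 M) j).hom φ) = (ev1 𝔞 M j).hom φ := by
  have h : colimit.ι (HD 𝔞 M) j ≫ evo 𝔞 M = ev1 𝔞 M j := colimit.ι_desc (evc 𝔞 M) j
  exact ConcreteCategory.congr_hom h φ

lemma tow_ext (𝔞 : Ideal R) (M : ModuleCat.{u} R) (j) (φ : (tow 𝔞).obj j ⟶ M)
    (h : φ.hom (uno 𝔞 j) = 0) : φ = 0 := by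
  ext x
  obtain ⟨r, rfl⟩ := uno_gen 𝔞 j x
  rw [map_smul, h, smul_zero, map_smul]
  exact (smul_zero r).symm

lemma evo_inj (𝔞 : Ideal R) (M : ModuleCat.{u} R) : Function.Injective (evo 𝔞 M).hom := by
  rw [injective_iff_map_eq_zero]
  intro y hy
  obtain ⟨j, φ, rfl⟩ := Concrete.colimit_exists_rep (HD 𝔞 M) y
  erw [evo_ι] at hy
  have := tow_ext 𝔞 M _ φ hy
  exact (congrArg (colimit.ι (HD 𝔞 M) j).hom this).trans (map_zero _)

lemma evo_range (𝔞 : Ideal R) (M : ModuleCat.{u} R) :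
    LinearMap.range (evo 𝔞 M).hom = Gam 𝔞 M := by
  ext m
  constructor
  · rintro ⟨y, rfl⟩
    obtain ⟨j, φ, rfl⟩ := Concrete.colimit_exists_rep (HD 𝔞 M) y
    erw [evo_ι]
    refine ⟨j.unop.unop, fun r hr => ?_⟩
    have h (ψ : (tow 𝔞).obj j.unop ⟶ M) : r • ψ.hom (uno 𝔞 j.unop) = 0 := by
      rw [← map_smul, uno_zero 𝔞 _ r hr, map_zero]
    exact h φ
  · rintro ⟨k, hk⟩
    let φ : (tow 𝔞).obj (op k) ⟶ M := ModuleCat.ofHom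
      (Submodule.liftQ (𝔞 ^ k) (LinearMap.toSpanSingleton R M m) (fun r hr => hk r hr))
    refine ⟨(colimit.ι (HD 𝔞 M) (op (op k))).hom φ, ?_⟩
    exact (evo_ι 𝔞 M (op (op k)) φ).trans (one_smul R m)

lemma evo_nat (𝔞 : Ideal R) {M N : ModuleCat.{u} R} (f : M ⟶ N) (x) :
    (evo 𝔞 N).hom ((colimMap (HDmap 𝔞 f)).hom x) = f.hom ((evo 𝔞 M).hom x) := by
  obtain ⟨j, φ, rfl⟩ := Concrete.colimit_exists_rep (HD 𝔞 M) x
  erw [colim_ι_map, evo_ι, evo_ι]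
  rfl

/-- degree zero local cohomology is torsion -/
noncomputable def L0 (𝔞 : Ideal R) (M : ModuleCat.{u} R) :
    (colimit (ED 𝔞 0 M) : ModuleCat.{u} R) ≃ₗ[R] Gam 𝔞 M :=
  (LinearEquiv.ofBijective (colimMap (th 𝔞 M)).hom
    ⟨colim_inj _ fun j => (th_bij 𝔞 M j).1, colim_surj _ fun j => (th_bij 𝔞 M j).2⟩).symm ≪≫ₗ
  LinearEquiv.ofInjective _ (evo_inj 𝔞 M) ≪≫ₗ LinearEquiv.ofEq _ _ (evo_range 𝔞 M)

lemma L0_nat (𝔞 : Ideal R) {M N : ModuleCat.{u} R} (f : M ⟶ N)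
    (x : (colimit (ED 𝔞 0 M) : ModuleCat.{u} R)) :
    (L0 𝔞 N ((colimMap (EDmap 𝔞 0 f)).hom x) : N) = f.hom (L0 𝔞 M x : M) := by
  have key (M : ModuleCat.{u} R) (z) : (L0 𝔞 M ((colimMap (th 𝔞 M)).hom z) : M) =
      (evo 𝔞 M).hom z := by
    simp only [L0, LinearEquiv.trans_apply, LinearEquiv.coe_ofEq_apply,
      LinearEquiv.ofInjective_apply]
    congr 1
    exact (LinearEquiv.ofBijective (colimMap (th 𝔞 M)).hom _).symm_apply_apply z
  obtain ⟨z, rfl⟩ := colim_surj _ (fun j => (th_bij 𝔞 M j).2) x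
  have h1 : (colimMap (EDmap 𝔞 0 f)).hom ((colimMap (th 𝔞 M)).hom z) =
      (colimMap (th 𝔞 N)).hom ((colimMap (HDmap 𝔞 f)).hom z) := by
    obtain ⟨j, φ, rfl⟩ := Concrete.colimit_exists_rep (HD 𝔞 M) z
    erw [colim_ι_map, colim_ι_map, colim_ι_map, colim_ι_map]
    congr 1
    exact ConcreteCategory.congr_hom (congr_app (th_nat 𝔞 f) j) φ
  rw [h1, key, key, evo_nat]

end lc3

/-- the value of local cohomology -/
noncomputable abbrev LL {R : Type u} [CommRing R] (𝔞 : Ideal R) (i : ℕ) (M : ModuleCat.{u} R) :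
    ModuleCat.{u} R := Limits.colimit (ED 𝔞 i M)

lemma LL_shift {R : Type u} [CommRing R] (𝔞 : Ideal R) (i : ℕ)
    {S : ShortComplex (ModuleCat.{u} R)} (hS : S.ShortExact) [Injective S.X₂] :
    ∃ g : LL 𝔞 i S.X₃ →ₗ[R] LL 𝔞 (i+1) S.X₁, Function.Surjective g ∧
      Function.Exact (Limits.colimMap (EDmap 𝔞 i S.g)).hom g :=
  ⟨(Limits.colimMap (EDconn hS 𝔞 i)).hom, colim_surj _ (ED_surj hS 𝔞 i),
    colim_exact _ _ (ED_exact hS 𝔞 i)⟩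

lemma LL_shift_succ {R : Type u} [CommRing R] (𝔞 : Ideal R) (i : ℕ)
    {S : ShortComplex (ModuleCat.{u} R)} (hS : S.ShortExact) [Injective S.X₂] :
    Nonempty (LL 𝔞 (i+1) S.X₃ ≃ₗ[R] LL 𝔞 (i+1+1) S.X₁) := by
  obtain ⟨g, hg, hg'⟩ := LL_shift 𝔞 (i+1) hS
  refine ⟨LinearEquiv.ofBijective g ⟨?_, hg⟩⟩
  rw [injective_iff_map_eq_zero]
  intro x hx
  obtain ⟨y, rfl⟩ := (hg' x).1 hx
  have := ED_inj 𝔞 i S.X₂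
  rw [Subsingleton.elim y 0, map_zero]

lemma LL_shift_zero {R : Type u} [CommRing R] (𝔞 : Ideal R)
    {S : ShortComplex (ModuleCat.{u} R)} (hS : S.ShortExact) [Injective S.X₂] :
    ∃ g : Gam 𝔞 S.X₃ →ₗ[R] LL 𝔞 1 S.X₁, Function.Surjective g ∧
      ∀ z, g z = 0 ↔ ∃ y ∈ Gam 𝔞 S.X₂, S.g.hom y = z := by
  obtain ⟨g, hg, hg'⟩ := LL_shift 𝔞 0 hS
  refine ⟨g ∘ₗ (L0 𝔞 S.X₃).symm.toLinearMap, hg.comp (L0 𝔞 S.X₃).symm.surjective, fun z => ?_⟩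
  refine (hg' _).trans ?_
  constructor
  · rintro ⟨y, hy⟩
    refine ⟨L0 𝔞 S.X₂ y, (L0 𝔞 S.X₂ y).2, ?_⟩
    rw [← L0_nat, hy]
    exact congrArg Subtype.val ((L0 𝔞 S.X₃).apply_symm_apply z)
  · rintro ⟨y, hy, hz⟩
    refine ⟨(L0 𝔞 S.X₂).symm ⟨y, hy⟩, ?_⟩
    apply (L0 𝔞 S.X₃).injective
    ext
    rw [L0_nat]
    rw [LinearEquiv.apply_symm_apply, hz]
    exact (congrArg Subtype.val ((L0 𝔞 S.X₃).apply_symm_apply z)).symm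

end FLC

namespace FLC
section cech
variable {R : Type u} [CommRing R]

/-- a sequence of modules and maps -/
structure Cx (R : Type u) [CommRing R] where
  /-- the terms -/
  X : ℕ → ModuleCat.{u} R
  /-- the differentials -/
  δ : ∀ i, X i →ₗ[R] X (i+1)

/-- terms of the fibre of localization -/
noncomputable def fibX (x : R) (K : Cx R) : ℕ → ModuleCat.{u} R
  | 0 => K.X 0
  | i+1 => ModuleCat.of R (K.X (i+1) × Lz x (K.X i))

/-- differentials of the fibre of localization -/
noncomputable def fibδ (x : R) (K : Cx R) : ∀ i, fibX x K i →ₗ[R] fibX x K (i+1)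
  | 0 => (K.δ 0).prod (ι x (K.X 0))
  | i+1 => ((K.δ (i+1)) ∘ₗ LinearMap.fst R (K.X (i+1)) (Lz x (K.X i))).prod
      (ι x (K.X (i+1)) ∘ₗ LinearMap.fst R (K.X (i+1)) (Lz x (K.X i)) -
        lz x (K.δ i) ∘ₗ LinearMap.snd R (K.X (i+1)) (Lz x (K.X i)))

/-- fibre of localization -/
noncomputable def fib (x : R) (K : Cx R) : Cx R := ⟨fibX x K, fibδ x K⟩

lemma fib_δ0 (x : R) (K : Cx R) (a : K.X 0) :
    (fib x K).δ 0 a = ((K.δ 0 a, ι x _ a) : K.X 1 × Lz x (K.X 0)) := rfl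

lemma fib_δs (x : R) (K : Cx R) (i : ℕ) (a : K.X (i+1)) (b : Lz x (K.X i)) :
    (fib x K).δ (i+1) ((a, b) : K.X (i+1) × Lz x (K.X i)) =
      ((K.δ (i+1) a, ι x _ a - lz x (K.δ i) b) : K.X (i+1+1) × Lz x (K.X (i+1))) := rfl

/-- terms of the trivial complex -/
def trivX (M : ModuleCat.{u} R) : ℕ → ModuleCat.{u} R
  | 0 => M
  | _+1 => ModuleCat.of R PUnit

/-- the Čech complex -/
noncomputable def cech : List R → ModuleCat.{u} R → Cx R
  | [], M => ⟨trivX M, fun _ => 0⟩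
  | x :: xs, M => fib x (cech xs M)

/-- degree zero term -/
noncomputable def ce : ∀ (xs : List R) (M : ModuleCat.{u} R), (cech xs M).X 0 ≃ₗ[R] M
  | [], M => LinearEquiv.refl R M
  | _ :: xs, M => ce xs M

lemma lz_zero (x : R) {A B C : Type u} [AddCommGroup A] [Module R A] [AddCommGroup B] [Module R B]
    [AddCommGroup C] [Module R C] (f : A →ₗ[R] B) (g : B →ₗ[R] C) (h : ∀ a, g (f a) = 0)
    (b : Lz x A) : lz x g (lz x f b) = 0 := by
  obtain ⟨⟨a, s⟩, rfl⟩ := IsLocalizedModule.mk'_surjective (Submonoid.powers x) (ι x A) b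
  simp [lz, ι, Function.uncurry, IsLocalizedModule.map_mk', h]

lemma cech_dd : ∀ (xs : List R) (M : ModuleCat.{u} R) (i : ℕ) (a : (cech xs M).X i),
    (cech xs M).δ (i+1) ((cech xs M).δ i a) = 0
  | [], M, i, a => rfl
  | x :: xs, M, 0, a => by
    refine (fib_δs x (cech xs M) 0 _ _).trans ?_
    exact Prod.ext (cech_dd xs M 0 a) (sub_eq_zero.2 (lz_ι x _ _).symm)
  | x :: xs, M, i+1, (a, b) => by
    refine (fib_δs x (cech xs M) (i+1) _ _).trans ?_
    refine Prod.ext (cech_dd xs M (i+1) a) ?_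
    change ι x _ _ - lz x _ (ι x _ a - lz x ((cech xs M).δ i) b) = 0
    rw [map_sub, lz_ι, lz_zero x _ _ (cech_dd xs M i), sub_zero]
    exact sub_self _

lemma Lz_subsingleton (x : R) (A : Type u) [AddCommGroup A] [Module R A] [Subsingleton A] :
    Subsingleton (Lz x A) := by
  refine ⟨fun a b => ?_⟩
  obtain ⟨⟨a, s⟩, rfl⟩ := IsLocalizedModule.mk'_surjective (Submonoid.powers x) (ι x A) a
  obtain ⟨⟨b, t⟩, rfl⟩ := IsLocalizedModule.mk'_surjective (Submonoid.powers x) (ι x A) b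
  simp [Function.uncurry, Subsingleton.elim a 0, Subsingleton.elim b 0]

lemma cech_sub : ∀ (xs : List R) (M : ModuleCat.{u} R) (i : ℕ) (_ : xs.length < i),
    Subsingleton ((cech xs M).X i)
  | [], M, i+1, _ => inferInstanceAs (Subsingleton PUnit)
  | x :: xs, M, i+1, h => by
    have h1 := cech_sub xs M i (by simpa using h)
    have h2 := cech_sub xs M (i+1) (by simp at h; omega)
    have h3 := Lz_subsingleton x ((cech xs M).X i)
    exact inferInstanceAs (Subsingleton (((cech xs M).X (i+1)) × Lz x ((cech xs M).X i)))

lemma cech_FD : ∀ (xs : List R) (M : ModuleCat.{u} R) (d : ℕ) (_ : FD R d M) (i : ℕ),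
    FD R d ((cech xs M).X i)
  | [], M, d, h, 0 => h
  | [], M, d, h, i+1 => by
    have := cech_sub ([] : List R) M (i+1) (by simp)
    exact FD_of_subsingleton d
  | x :: xs, M, d, h, 0 => cech_FD xs M d h 0
  | x :: xs, M, d, h, i+1 =>
    FD.prod (cech_FD xs M d h (i+1)) (FD.localized x d _ (cech_FD xs M d h i))

lemma cech_EZ [IsLocalRing R] : ∀ (xs : List R) (_ : ∀ x ∈ xs, x ∈ maximalIdeal R)
    (M : ModuleCat.{u} R) (i j : ℕ), EZ (kk R) j ((cech xs M).X (i+1))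
  | [], _, M, i, j => by
    have := cech_sub ([] : List R) M (i+1) (by simp)
    exact EZ_of_subsingleton j
  | x :: xs, h, M, i, j => by
    refine EZ.prod (cech_EZ xs (fun y hy => h y (List.mem_cons_of_mem _ hy)) M i j) ?_
    refine EZ.localized x ?_ j (Lz_bij x)
    intro y
    have h1 : residue R x = 0 := (residue_eq_zero_iff x).2 (h x List.mem_cons_self)
    obtain ⟨r, rfl⟩ := residue_surjective (R := R) y
    change x • residue R r = 0
    rw [Algebra.smul_def]
    change residue R x * _ = 0
    rw [h1, zero_mul]

lemma ι_zero (x : R) {A : Type u} [AddCommGroup A] [Module R A] (a : A) :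
    ι x A a = 0 ↔ ∃ k : ℕ, x ^ k • a = 0 := by
  rw [IsLocalizedModule.eq_zero_iff (Submonoid.powers x)]
  constructor
  · rintro ⟨⟨_, k, rfl⟩, h⟩
    exact ⟨k, h⟩
  · rintro ⟨k, h⟩
    exact ⟨⟨_, k, rfl⟩, h⟩

lemma pow_smul_equiv (x : R) {A B : Type u} [AddCommGroup A] [Module R A] [AddCommGroup B]
    [Module R B] (e : A ≃ₗ[R] B) (a : A) :
    (∃ k : ℕ, x ^ k • a = 0) ↔ ∃ k : ℕ, x ^ k • e a = 0 := by
  refine exists_congr fun k => ?_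
  rw [← LinearEquiv.map_smul]
  exact (map_eq_zero_iff e e.injective).symm

lemma cech_ker0 : ∀ (xs : List R) (M : ModuleCat.{u} R) (a : (cech xs M).X 0),
    (cech xs M).δ 0 a = 0 ↔ ∀ x ∈ xs, ∃ k : ℕ, x ^ k • ce xs M a = 0
  | [], M, a => ⟨fun _ x hx => absurd hx List.not_mem_nil, fun _ => rfl⟩
  | x :: xs, M, a => by
    have h1 := cech_ker0 xs M a
    have h2 := ι_zero x (A := (cech xs M).X 0) a
    have h3 := pow_smul_equiv x (ce xs M) a
    refine (Prod.ext_iff (α := (cech xs M).X 1) (β := Lz x ((cech xs M).X 0))).trans ?_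
    rw [List.forall_mem_cons, and_comm]
    exact and_congr (h2.trans h3) h1

end cech
end FLC

namespace FLC
section cech2
variable {R : Type u} [CommRing R]

lemma inj_div [IsNoetherianRing R] {M : Type u} [AddCommGroup M] [Module R M]
    (hM : Module.Injective R M) (a : M) (x : R) (k : ℕ) :
    ∃ b : M, (∀ r : R, r • a = 0 → r • b = 0) ∧ ∃ N : ℕ, x ^ (N + k) • b = x ^ N • a := by
  let s : ℕ →o Submodule R R :=
    { toFun := fun N => LinearMap.ker (LinearMap.toSpanSingleton R M (x ^ N • a))
      monotone' := by
        intro p q hpq r hr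
        obtain ⟨t, rfl⟩ := Nat.exists_eq_add_of_le hpq
        simp only [LinearMap.mem_ker, LinearMap.toSpanSingleton_apply] at hr ⊢
        rw [pow_add, mul_comm, mul_smul, smul_comm r, hr, smul_zero] }
  obtain ⟨N, hN⟩ := monotone_stabilizes_iff_noetherian.2 (inferInstanceAs (IsNoetherian R R)) s
  let J : Submodule R R := LinearMap.ker (LinearMap.toSpanSingleton R M a)
  let φ : R →ₗ[R] (R ⧸ J) := J.mkQ ∘ₗ LinearMap.toSpanSingleton R R (x ^ (N + k))
  let ψ : R →ₗ[R] M := LinearMap.toSpanSingleton R M (x ^ N • a)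
  have hφ : LinearMap.ker φ ≤ LinearMap.ker ψ := by
    intro r hr
    have h1 : r • x ^ (N + k) ∈ J := (Submodule.Quotient.mk_eq_zero J).1 hr
    have h2 : r ∈ s (N + k) := by
      change r • x ^ (N + k) • a = 0
      rw [← smul_assoc]
      exact h1
    rw [← hN (N + k) (Nat.le_add_right _ _)] at h2
    exact h2
  have hi : Function.Injective ((LinearMap.ker φ).liftQ φ le_rfl) := by
    rw [← LinearMap.ker_eq_bot]
    exact Submodule.ker_liftQ_eq_bot _ _ _ le_rfl
  obtain ⟨h, hh⟩ := hM.out _ hi ((LinearMap.ker φ).liftQ ψ hφ)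
  refine ⟨h (Submodule.Quotient.mk 1), fun r hr => ?_, N, ?_⟩
  · rw [← map_smul, ← Submodule.Quotient.mk_smul, smul_eq_mul, mul_one,
      (Submodule.Quotient.mk_eq_zero J).2 (show r • a = 0 from hr), map_zero]
  · rw [← map_smul, ← Submodule.Quotient.mk_smul, smul_eq_mul, mul_one]
    have := hh (Submodule.Quotient.mk 1)
    rw [Submodule.liftQ_apply, Submodule.liftQ_apply] at this
    simpa [φ, ψ] using this

lemma cech_lift0 [IsNoetherianRing R] (x : R) (xs : List R) (M : ModuleCat.{u} R)
    (hM : Module.Injective R M) (b : Lz x ((cech xs M).X 0))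
    (hb : lz x ((cech xs M).δ 0) b = 0) :
    ∃ z : (cech xs M).X 0, (cech xs M).δ 0 z = 0 ∧ ι x _ z = b := by
  obtain ⟨⟨c, ⟨_, k, rfl⟩⟩, rfl⟩ :=
    IsLocalizedModule.mk'_surjective (Submonoid.powers x) (ι x ((cech xs M).X 0)) b
  have h1 : ∃ N : ℕ, x ^ N • (cech xs M).δ 0 c = 0 := by
    rw [← ι_zero, ← lz_ι]
    rw [Function.uncurry_apply_pair] at hb
    have h2 := IsLocalizedModule.mk'_cancel' (ι x ((cech xs M).X 0)) c
      (⟨x ^ k, k, rfl⟩ : Submonoid.powers x)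
    rw [← h2]
    change lz x _ (x ^ k • _) = 0
    rw [map_smul, hb, smul_zero]
  obtain ⟨N, hN⟩ := h1
  obtain ⟨z, hz, N', hz'⟩ := inj_div hM (ce xs M (x ^ N • c)) x (N + k)
  refine ⟨(ce xs M).symm z, ?_, ?_⟩
  · rw [cech_ker0, LinearEquiv.apply_symm_apply]
    intro y hy
    rw [← map_smul, cech_ker0] at hN
    obtain ⟨l, hl⟩ := hN y hy
    exact ⟨l, hz _ hl⟩
  · rw [Function.uncurry_apply_pair]
    symm
    rw [IsLocalizedModule.mk'_eq_iff]
    change ι x _ c = x ^ k • _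
    rw [← map_smul, ← sub_eq_zero, ← map_sub, ι_zero]
    refine ⟨N' + N, (ce xs M).injective ?_⟩
    rw [smul_sub, map_sub, ← mul_smul, ← pow_add, map_smul, map_smul, map_zero,
      LinearEquiv.apply_symm_apply, add_assoc, hz', map_smul, ← mul_smul, ← pow_add, sub_self]

lemma cech_exact [IsNoetherianRing R] : ∀ (xs : List R) (M : ModuleCat.{u} R)
    (_ : Module.Injective R M) (i : ℕ) (a : (cech xs M).X (i+1)) (_ : (cech xs M).δ (i+1) a = 0),
    ∃ b, (cech xs M).δ i b = a
  | [], M, _, i, a, _ => ⟨0, rfl⟩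
  | x :: xs, M, hM, 0, (a, b), h => by
    obtain ⟨h1, h2⟩ := Prod.ext_iff.1 h
    obtain ⟨a', rfl⟩ := cech_exact xs M hM 0 a h1
    have h2' : ι x _ ((cech xs M).δ 0 a') - lz x ((cech xs M).δ 0) b = 0 := h2
    obtain ⟨z, hz, hz'⟩ := cech_lift0 x xs M hM (b - ι x _ a') (by
      rw [map_sub, lz_ι, ← neg_sub, h2', neg_zero])
    refine ⟨(a' + z : (cech xs M).X 0), ?_⟩
    refine (fib_δ0 x (cech xs M) (a' + z)).trans ?_
    rw [map_add, map_add, hz, hz', add_zero, add_sub_cancel]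
  | x :: xs, M, hM, i+1, (a, b), h => by
    obtain ⟨h1, h2⟩ := Prod.ext_iff.1 h
    obtain ⟨a', rfl⟩ := cech_exact xs M hM (i+1) a h1
    have h2' : ι x _ ((cech xs M).δ (i+1) a') - lz x ((cech xs M).δ (i+1)) b = 0 := h2
    have he : Function.Exact ((cech xs M).δ i) ((cech xs M).δ (i+1)) := fun y =>
      ⟨fun hy => cech_exact xs M hM i y hy, by rintro ⟨w, rfl⟩; exact cech_dd xs M i w⟩
    obtain ⟨c, hc⟩ := (lz_exact x _ _ he (ι x _ a' - b)).1 (by rw [map_sub, lz_ι, h2'])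
    refine ⟨((a', c) : (cech xs M).X (i+1) × Lz x ((cech xs M).X i)), ?_⟩
    refine (fib_δs x (cech xs M) i a' c).trans ?_
    rw [hc, sub_sub_cancel]

/-- short exact sequence of complexes -/
structure SC (A B C : Cx R) (f : ∀ i, A.X i →ₗ[R] B.X i) (g : ∀ i, B.X i →ₗ[R] C.X i) : Prop where
  cf : ∀ i a, f (i+1) (A.δ i a) = B.δ i (f i a)
  cg : ∀ i a, g (i+1) (B.δ i a) = C.δ i (g i a)
  inj : ∀ i, Function.Injective (f i)
  surj : ∀ i, Function.Surjective (g i)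
  ex : ∀ i, Function.Exact (f i) (g i)

/-- functoriality of the fibre -/
noncomputable def fibM (x : R) {A B : Cx R} (f : ∀ i, A.X i →ₗ[R] B.X i) :
    ∀ i, (fib x A).X i →ₗ[R] (fib x B).X i
  | 0 => f 0
  | i+1 => (f (i+1)).prodMap (lz x (f i))

lemma fibM_s (x : R) {A B : Cx R} (f : ∀ i, A.X i →ₗ[R] B.X i) (i : ℕ)
    (a : A.X (i+1)) (b : Lz x (A.X i)) :
    fibM x f (i+1) ((a, b) : A.X (i+1) × Lz x (A.X i)) =
      ((f (i+1) a, lz x (f i) b) : B.X (i+1) × Lz x (B.X i)) := rfl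

lemma lz_comm (x : R) {A B C D : Type u} [AddCommGroup A] [Module R A] [AddCommGroup B]
    [Module R B] [AddCommGroup C] [Module R C] [AddCommGroup D] [Module R D]
    (f : A →ₗ[R] B) (g : B →ₗ[R] D) (f' : A →ₗ[R] C) (g' : C →ₗ[R] D)
    (h : ∀ a, g (f a) = g' (f' a)) (b : Lz x A) : lz x g (lz x f b) = lz x g' (lz x f' b) := by
  obtain ⟨⟨a, s⟩, rfl⟩ := IsLocalizedModule.mk'_surjective (Submonoid.powers x) (ι x A) b
  simp [lz, ι, Function.uncurry, IsLocalizedModule.map_mk', h]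

lemma fibM_comm (x : R) {A B : Cx R} (f : ∀ i, A.X i →ₗ[R] B.X i)
    (cf : ∀ i a, f (i+1) (A.δ i a) = B.δ i (f i a)) :
    ∀ i a, fibM x f (i+1) ((fib x A).δ i a) = (fib x B).δ i (fibM x f i a)
  | 0, a => Prod.ext (cf 0 a) (lz_ι x _ _)
  | i+1, (a, b) => by
    refine Prod.ext (cf (i+1) a) ?_
    change lz x (f (i+1)) (ι x _ a - lz x (A.δ i) b) = ι x _ (f (i+1) a) - lz x (B.δ i) (lz x (f i) b)
    rw [map_sub, lz_ι, lz_comm x _ _ _ _ (cf i)]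

lemma SC.fib (x : R) {A B C : Cx R} {f : ∀ i, A.X i →ₗ[R] B.X i} {g : ∀ i, B.X i →ₗ[R] C.X i}
    (h : SC A B C f g) : SC (fib x A) (fib x B) (fib x C) (fibM x f) (fibM x g) where
  cf := fibM_comm x f h.cf
  cg := fibM_comm x g h.cg
  inj
    | 0 => h.inj 0
    | i+1 => (h.inj (i+1)).prodMap (lz_inj x _ (h.inj i))
  surj
    | 0 => h.surj 0
    | i+1 => (h.surj (i+1)).prodMap (lz_surj x _ (h.surj i))
  ex
    | 0 => h.ex 0
    | i+1 => fun ⟨a, b⟩ => by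
      have h1 := h.ex (i+1) a
      have h2 := lz_exact x _ _ (h.ex i) b
      refine Prod.ext_iff.trans ((and_congr h1 h2).trans ?_)
      constructor
      · rintro ⟨⟨p, hp⟩, q, hq⟩
        exact ⟨(p, q), Prod.ext hp hq⟩
      · rintro ⟨⟨p, q⟩, hpq⟩
        exact ⟨⟨p, congrArg Prod.fst hpq⟩, q, congrArg Prod.snd hpq⟩

/-- functoriality of the Čech complex -/
noncomputable def cechM : ∀ (xs : List R) {M N : ModuleCat.{u} R} (_ : M →ₗ[R] N) (i : ℕ),
    (cech xs M).X i →ₗ[R] (cech xs N).X i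
  | [], _, _, f, 0 => f
  | [], _, _, _, _+1 => 0
  | x :: xs, _, _, f, i => fibM x (cechM xs f) i

lemma cechM_zero : ∀ (xs : List R) {M N : ModuleCat.{u} R} (f : M →ₗ[R] N) (a : (cech xs M).X 0),
    ce xs N (cechM xs f 0 a) = f (ce xs M a)
  | [], _, _, _, _ => rfl
  | _ :: xs, _, _, f, a => cechM_zero xs f a

lemma cech_SC : ∀ (xs : List R) {M N P : ModuleCat.{u} R} (f : M →ₗ[R] N) (g : N →ₗ[R] P)
    (_ : Function.Injective f) (_ : Function.Surjective g) (_ : Function.Exact f g),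
    SC (cech xs M) (cech xs N) (cech xs P) (cechM xs f) (cechM xs g)
  | [], M, N, P, f, g, hf, hg, h =>
    { cf := fun _ _ => rfl
      cg := fun _ _ => rfl
      inj := fun i => match i with
        | 0 => hf
        | _+1 => fun _ _ _ => rfl
      surj := fun i => match i with
        | 0 => hg
        | _+1 => fun _ => ⟨0, rfl⟩
      ex := fun i => match i with
        | 0 => h
        | _+1 => fun _ => ⟨fun _ => ⟨0, rfl⟩, fun _ => rfl⟩ }
  | x :: xs, M, N, P, f, g, hf, hg, h => (cech_SC xs f g hf hg h).fib x

/-- dimension shifting -/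
lemma SC.shift {A B C : Cx R} {f : ∀ i, A.X i →ₗ[R] B.X i} {g : ∀ i, B.X i →ₗ[R] C.X i}
    (h : SC A B C f g) (i : ℕ) (hA : ∀ a, A.δ (i+1) (A.δ i a) = 0)
    (hdd : ∀ b, B.δ (i+1) (B.δ i b) = 0)
    (hBd : ∀ b ∈ Bd B.X B.δ i, B.δ i b = 0)
    (hB : ∀ b, B.δ (i+1) b = 0 → ∃ c, B.δ i c = b) (H : Type u) [AddCommGroup H] [Module R H]
    (g0 : LinearMap.ker (C.δ i) →ₗ[R] H) (hg0 : Function.Surjective g0)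
    (hk : ∀ z, g0 z = 0 ↔ ∃ y, B.δ i y = 0 ∧ ∃ w ∈ Bd C.X C.δ i, g i y + w = z) :
    ∃ k : LinearMap.ker (A.δ (i+1)) →ₗ[R] H, Function.Surjective k ∧
      ∀ z, k z = 0 ↔ (z : A.X (i+1)) ∈ Bd A.X A.δ (i+1) := by
  let T : Submodule R (B.X i) := LinearMap.ker (g (i+1) ∘ₗ B.δ i)
  have hT (b : T) : g (i+1) (B.δ i b) = 0 := b.2
  let fe := LinearEquiv.ofInjective (f (i+1)) (h.inj (i+1))
  have hq1 (b : T) : B.δ i b ∈ LinearMap.range (f (i+1)) := (h.ex (i+1) _).1 (hT b)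
  let q0 : T →ₗ[R] A.X (i+1) := fe.symm.toLinearMap ∘ₗ
    LinearMap.codRestrict (LinearMap.range (f (i+1))) (B.δ i ∘ₗ T.subtype) hq1
  have hq0 (b : T) : f (i+1) (q0 b) = B.δ i b := by
    have := fe.apply_symm_apply ⟨B.δ i b, hq1 b⟩
    exact congrArg Subtype.val this
  have hq2 (b : T) : A.δ (i+1) (q0 b) = 0 := by
    apply h.inj
    rw [h.cf, hq0, hdd, map_zero]
  let q : T →ₗ[R] LinearMap.ker (A.δ (i+1)) := LinearMap.codRestrict _ q0 hq2
  have hqs : Function.Surjective q := by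
    rintro ⟨a, ha⟩
    obtain ⟨c, hc⟩ := hB (f (i+1) a) (by rw [← h.cf, LinearMap.mem_ker.1 ha, map_zero])
    have hcT : c ∈ T := by
      change g (i+1) (B.δ i c) = 0
      rw [hc]
      exact (h.ex _ _).2 ⟨a, rfl⟩
    refine ⟨⟨c, hcT⟩, Subtype.ext (h.inj _ ?_)⟩
    exact (hq0 ⟨c, hcT⟩).trans hc
  have hr1 (b : T) : C.δ i (g i b) = 0 := by rw [← h.cg]; exact hT b
  let r : T →ₗ[R] H := g0 ∘ₗ LinearMap.codRestrict _ (g i ∘ₗ T.subtype) hr1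
  have hr (b : T) : r b = g0 ⟨g i b, hr1 b⟩ := rfl
  have hrs : Function.Surjective r := by
    intro y
    obtain ⟨⟨c, hc⟩, rfl⟩ := hg0 y
    obtain ⟨b, rfl⟩ := h.surj i c
    have hb : b ∈ T := by
      change g (i+1) (B.δ i b) = 0
      rw [h.cg]; exact hc
    exact ⟨⟨b, hb⟩, rfl⟩
  have hqr : LinearMap.ker q ≤ LinearMap.ker r := by
    intro b hb
    have hb' : q0 b = 0 := congrArg Subtype.val (LinearMap.mem_ker.1 hb)
    rw [LinearMap.mem_ker, hr, hk]
    refine ⟨b, ?_, 0, Submodule.zero_mem _, add_zero _⟩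
    rw [← hq0, hb', map_zero]
  let k := (LinearMap.ker q).liftQ r hqr ∘ₗ
    (q.quotKerEquivOfSurjective hqs).symm.toLinearMap
  have hkq (b : T) : k (q b) = r b := by
    have : (q.quotKerEquivOfSurjective hqs).symm (q b) = Submodule.Quotient.mk b := by
      rw [LinearEquiv.symm_apply_eq]; rfl
    change (LinearMap.ker q).liftQ r hqr ((q.quotKerEquivOfSurjective hqs).symm (q b)) = _
    rw [this]; rfl
  refine ⟨k, fun y => ?_, fun z => ?_⟩
  · obtain ⟨b, rfl⟩ := hrs y
    exact ⟨q b, hkq b⟩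
  · obtain ⟨b, rfl⟩ := hqs z
    rw [hkq, hr, hk]
    change _ ↔ q0 b ∈ LinearMap.range (A.δ i)
    constructor
    · rintro ⟨y, hy, w, hw, hyw⟩
      have hyw : g i y + w = g i b := hyw
      obtain ⟨w', hw', rfl⟩ : ∃ w' ∈ Bd B.X B.δ i, g i w' = w := by
        cases i with
        | zero =>
          have : w = 0 := hw
          exact ⟨0, Submodule.zero_mem _, by rw [this, map_zero]⟩
        | succ i =>
          obtain ⟨v, rfl⟩ := hw
          obtain ⟨v', rfl⟩ := h.surj i v
          exact ⟨B.δ i v', ⟨v', rfl⟩, h.cg i v'⟩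
      obtain ⟨a, ha⟩ := (h.ex i (b - (y + w'))).1 (by rw [map_sub, map_add, hyw, sub_self])
      refine ⟨a, h.inj _ ?_⟩
      rw [h.cf, ha, hq0, map_sub, map_add, hy, hBd w' hw', add_zero, sub_zero]
    · rintro ⟨a, ha⟩
      refine ⟨b - f i a, ?_, 0, Submodule.zero_mem _, ?_⟩
      · rw [map_sub, ← h.cf, ha, hq0, sub_self]
      · rw [add_zero, map_sub, (h.ex i _).2 ⟨a, rfl⟩, sub_zero]

end cech2
end FLC

namespace FLC
section fin
variable {R : Type u} [CommRing R]

lemma Gam_mem (xs : List R) (𝔞 : Ideal R) (h𝔞 : 𝔞 = Ideal.span {x | x ∈ xs})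
    (M : Type u) [AddCommGroup M] [Module R M] (m : M) :
    m ∈ Gam 𝔞 M ↔ ∀ x ∈ xs, ∃ k : ℕ, x ^ k • m = 0 := by
  constructor
  · rintro ⟨k, hk⟩ x hx
    refine ⟨k, hk _ (Ideal.pow_mem_pow ?_ k)⟩
    rw [h𝔞]
    exact Ideal.subset_span hx
  · intro h
    let J : Ideal R := LinearMap.ker (LinearMap.toSpanSingleton R M m)
    have h1 : 𝔞 ≤ J.radical := by
      rw [h𝔞, Ideal.span_le]
      intro x hx
      obtain ⟨k, hk⟩ := h x hx
      exact ⟨k, hk⟩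
    have hfg : 𝔞.FG := by
      rw [h𝔞]
      classical
      exact ⟨xs.toFinset, by simp⟩
    obtain ⟨k, hk⟩ := Ideal.exists_pow_le_of_le_radical_of_fg h1 hfg
    exact ⟨k, fun r hr => hk hr⟩

/-- degree zero Čech cohomology -/
noncomputable def kerGam (xs : List R) (𝔞 : Ideal R) (h𝔞 : 𝔞 = Ideal.span {x | x ∈ xs})
    (M : ModuleCat.{u} R) : LinearMap.ker ((cech xs M).δ 0) ≃ₗ[R] Gam 𝔞 M :=
  (ce xs M).ofSubmodules _ _ (by
    ext m
    rw [Gam_mem xs 𝔞 h𝔞]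
    constructor
    · rintro ⟨a, ha, rfl⟩
      exact (cech_ker0 xs M a).1 ha
    · intro h
      refine ⟨(ce xs M).symm m, ?_, (ce xs M).apply_symm_apply m⟩
      refine (cech_ker0 xs M _).2 ?_
      rw [LinearEquiv.apply_symm_apply]
      exact h)

lemma kerGam_apply (xs : List R) (𝔞 : Ideal R) (h𝔞 : 𝔞 = Ideal.span {x | x ∈ xs})
    (M : ModuleCat.{u} R) (z) : (kerGam xs 𝔞 h𝔞 M z : M) = ce xs M z := rfl

lemma inj_ses (M : ModuleCat.{u} R) : ∃ S : ShortComplex (ModuleCat.{u} R), S.ShortExact ∧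
    Injective S.X₂ ∧ S.X₁ = M := by
  refine ⟨ShortComplex.mk (Injective.ι M) (Limits.cokernel.π _) (Limits.cokernel.condition _),
    ?_, ?_, rfl⟩
  · exact { exact := ShortComplex.exact_cokernel _
            mono_f := inferInstanceAs (Mono (Injective.ι M))
            epi_g := inferInstanceAs (Epi (Limits.cokernel.π _)) }
  · exact inferInstanceAs (Injective (Injective.under M))

theorem cech_LL [IsNoetherianRing R] (xs : List R) (𝔞 : Ideal R)
    (h𝔞 : 𝔞 = Ideal.span {x | x ∈ xs}) : ∀ (i : ℕ) (M : ModuleCat.{u} R),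
    ∃ k : LinearMap.ker ((cech xs M).δ i) →ₗ[R] LL 𝔞 i M, Function.Surjective k ∧
      ∀ z, k z = 0 ↔ (z : (cech xs M).X i) ∈ Bd (cech xs M).X (cech xs M).δ i
  | 0, M => by
    let e := (kerGam xs 𝔞 h𝔞 M).trans (L0 𝔞 M).symm
    refine ⟨e.toLinearMap, e.surjective, fun z => ?_⟩
    refine (map_eq_zero_iff e e.injective).trans ?_
    exact ⟨fun h => congrArg Subtype.val h, fun h => Subtype.ext h⟩
  | i+1, M => by
    obtain ⟨S, hS, hI, rfl⟩ := inj_ses M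
    have hI' : Module.Injective R S.X₂ := Module.injective_module_of_injective_object R S.X₂
    have sc := cech_SC xs S.f.hom S.g.hom hS.moduleCat_injective_f hS.moduleCat_surjective_g
      ((ShortComplex.ShortExact.moduleCat_exact_iff_function_exact S).1 hS.exact)
    cases i with
    | zero =>
      obtain ⟨g, hg, hg'⟩ := LL_shift_zero 𝔞 hS
      refine sc.shift 0 (cech_dd xs _ 0) (cech_dd xs _ 0) ?_ (cech_exact xs _ hI' 0) _
        (g ∘ₗ (kerGam xs 𝔞 h𝔞 S.X₃).toLinearMap)
        (hg.comp (kerGam xs 𝔞 h𝔞 S.X₃).surjective) ?_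
      · intro b hb
        have : b = 0 := hb
        rw [this, map_zero]
      · intro z
        refine (hg' _).trans ?_
        constructor
        · rintro ⟨y, hy, hyz⟩
          obtain ⟨w, hw⟩ := (kerGam xs 𝔞 h𝔞 S.X₂).surjective ⟨y, hy⟩
          refine ⟨w, w.2, 0, Submodule.zero_mem _, ?_⟩
          apply (ce xs S.X₃).injective
          have hw' : ce xs S.X₂ w = y := congrArg Subtype.val hw
          rw [add_zero, cechM_zero, hw', hyz]
          rfl
        · rintro ⟨y, hy, w, hw, hyz⟩
          have hw0 : w = 0 := hw
          refine ⟨ce xs S.X₂ y, (kerGam xs 𝔞 h𝔞 S.X₂ ⟨y, hy⟩).2, ?_⟩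
          rw [← cechM_zero]
          refine congrArg (ce xs S.X₃) ?_
          exact (by rw [hw0, add_zero] : _ = _).trans hyz
    | succ i =>
      obtain ⟨e⟩ := LL_shift_succ 𝔞 i hS
      obtain ⟨k, hk, hk'⟩ := cech_LL xs 𝔞 h𝔞 (i+1) S.X₃
      refine sc.shift (i+1) (cech_dd xs _ (i+1)) (cech_dd xs _ (i+1)) ?_
        (cech_exact xs _ hI' (i+1)) _ (e.toLinearMap ∘ₗ k) (e.surjective.comp hk) ?_
      · rintro _ ⟨b, rfl⟩
        exact cech_dd xs _ i b
      · intro z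
        refine (map_eq_zero_iff e e.injective).trans ((hk' z).trans ?_)
        constructor
        · intro hz
          exact ⟨0, map_zero _, z, hz, by rw [map_zero, zero_add]⟩
        · rintro ⟨y, hy, w, hw, hyz⟩
          rw [← hyz]
          refine Submodule.add_mem _ ?_ hw
          obtain ⟨v, rfl⟩ := cech_exact xs _ hI' i y hy
          exact ⟨cechM xs S.g.hom i v, (sc.cg i v).symm⟩

end fin
end FLC

/-- **Theorem 3.1.** Let `(R, 𝔪)` be a commutative Noetherian local ring, `𝔞` a proper
ideal and `M` an `R`-module with `H^i_𝔞(M) = 0` for all `i ≠ n`. Then finiteness of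
`fd_R M` implies that of `fd_R H^n_𝔞(M)`; the converse holds if `M` is finitely
generated; and if `M` is non-zero finitely generated then
`fd_R H^n_𝔞(M) = fd_R M + n = pd_R M + n`. -/
theorem flatDim_localCohomology
    (R : Type u) [CommRing R] [IsNoetherianRing R] [IsLocalRing R]
    (𝔞 : Ideal R) (h𝔞 : 𝔞 ≠ ⊤)
    (M : Type u) [AddCommGroup M] [Module R M] (n : ℕ)
    (hvan : ∀ i : ℕ, i ≠ n → Subsingleton (lcoh R 𝔞 i M)) :
    (flatDim R M ≠ ⊤ → flatDim R (lcoh R 𝔞 n M) ≠ ⊤) ∧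
    (Module.Finite R M → flatDim R (lcoh R 𝔞 n M) ≠ ⊤ → flatDim R M ≠ ⊤) ∧
    (Module.Finite R M → Nontrivial M →
      flatDim R (lcoh R 𝔞 n M) = flatDim R M + n ∧
      flatDim R (lcoh R 𝔞 n M) = projDim R M + n) := by
  obtain ⟨s, hs⟩ := IsNoetherian.noetherian 𝔞
  have hspan : 𝔞 = Ideal.span {x | x ∈ s.toList} := by
    rw [← hs]
    congr 1
    ext x
    simp
  have hm : ∀ x ∈ s.toList, x ∈ maximalIdeal R := fun x hx =>
    IsLocalRing.le_maximalIdeal h𝔞 (by rw [hspan]; exact Ideal.subset_span hx)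
  have hc := FLC.cech_LL s.toList 𝔞 hspan
  let N := ModuleCat.of R M
  refine FLC.main_of_conc M n s.toList.length (lcoh R 𝔞 n M) (FLC.cech s.toList N).X
    (FLC.cech s.toList N).δ ?_ (FLC.ce s.toList N) (FLC.cech_EZ s.toList hm N)
    (FLC.cech_FD s.toList N)
  have hle : ∀ i, FLC.Bd (FLC.cech s.toList N).X (FLC.cech s.toList N).δ i ≤
      LinearMap.ker ((FLC.cech s.toList N).δ i) := by
    intro i
    cases i with
    | zero => exact bot_le
    | succ i =>
      rintro _ ⟨b, rfl⟩
      exact FLC.cech_dd s.toList N i b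
  refine ⟨FLC.cech_sub s.toList N, fun i hi => ?_, ?_, hle n⟩
  · refine le_antisymm (fun z hz => ?_) (hle i)
    obtain ⟨k, -, hk'⟩ := hc i N
    have h1 : Subsingleton ((localCohomology 𝔞 i).obj N) := hvan i hi
    have h2 : Subsingleton (FLC.LL 𝔞 i N) := (FLC.lcIso 𝔞 i N).toLinearEquiv.symm.subsingleton
    exact (hk' ⟨z, hz⟩).1 (Subsingleton.elim _ _)
  · obtain ⟨k, hk, hk'⟩ := hc n N
    let e : FLC.LL 𝔞 n N ≃ₗ[R] lcoh R 𝔞 n M := (FLC.lcIso 𝔞 n N).toLinearEquiv.symm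
    refine ⟨e.toLinearMap ∘ₗ k, e.surjective.comp hk, fun z => ?_⟩
    exact (map_eq_zero_iff e e.injective).trans (hk' z)
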